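/- There exists a universal constant α > 0 with the following property. Let C ⊆ ℝ² be a convex body, let 𝒮 be a finite family of homothets of C, let 𝒪 ⊆ 𝒮 be a dominating set of 𝒮 of minimum cardinality, and let 0 < ε < 1. Suppose 𝒬 ⊆ 𝒮 is a dominating set of 𝒮 that is b-locally optimal for some integer b ≥ α/ε², and that additionally satisfies the stability condition: there is no Q ∈ 𝒬 and R ∈ 𝒮 \ 𝒬 such that Q \ ⋃_{P ∈ 𝒬, P ≠ Q} P ⊆ R. Then |𝒬| ≤ (1+ε)·|𝒪|. -/

import Mathlib

open Set

attribute [local instance] Classical.propDecidable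

/-- The Euclidean plane. -/
abbrev Plane := EuclideanSpace ℝ (Fin 2)

/-- `S` is a homothet (translated and positively scaled copy) of `C`. -/
def IsHomothetOf (C S : Set Plane) : Prop :=
  ∃ (x : Plane) (t : ℝ), 0 < t ∧ S = (fun y => x + t • y) '' C

/-- `𝒬` is a dominating set of the family `𝒮`: every member of `𝒮`
intersects some member of `𝒬`. -/
def DominatingIn (𝒮 𝒬 : Finset (Set Plane)) : Prop :=
  ∀ S ∈ 𝒮, ∃ Q ∈ 𝒬, (S ∩ Q).Nonempty

/-- `𝒬` is a `b`-locally optimal dominating set of `𝒮`: one cannot remove a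
subset `X ⊆ 𝒬` of size at most `b` and replace it by a strictly smaller subset
of `𝒮` while remaining dominating. -/
def BLocallyOptimalDom (𝒮 𝒬 : Finset (Set Plane)) (b : ℕ) : Prop :=
  ¬ ∃ X : Finset (Set Plane), X ⊆ 𝒬 ∧ X.card ≤ b ∧
      ∃ X' : Finset (Set Plane), X' ⊆ 𝒮 ∧ X'.card < X.card ∧
        DominatingIn 𝒮 ((𝒬 \ X) ∪ X')

namespace GraphSeparation

variable {V : Type*} {adj : V → V → Prop}

/-- Reachability in `T` along `adj`. -/
def Reach (adj : V → V → Prop) (T : Finset V) : V → V → Prop :=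
  Relation.ReflTransGen fun a b => adj a b ∧ a ∈ T ∧ b ∈ T

/-- `T` is nonempty and induces a connected subgraph. -/
def ConnSet (adj : V → V → Prop) (T : Finset V) : Prop :=
  T.Nonempty ∧ ∀ u ∈ T, ∀ v ∈ T, Reach adj T u v

/-- `K` is a connected component of the subgraph induced on `W \ X`. -/
def IsComp (adj : V → V → Prop) (W X K : Finset V) : Prop :=
  K ⊆ W ∧ Disjoint K X ∧ ConnSet adj K ∧ ∀ u ∈ K, ∀ v ∈ W, adj u v → v ∉ X → v ∈ K

/-- There is no `K₅` minor. -/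
def NoK5 (adj : V → V → Prop) : Prop :=
  ¬ ∃ B : Fin 5 → Finset V, (∀ i, ConnSet adj (B i)) ∧
    (∀ i j, i ≠ j → Disjoint (B i) (B j)) ∧
    ∀ i j, i ≠ j → ∃ u ∈ B i, ∃ v ∈ B j, adj u v

theorem Reach.symm (hs : ∀ u v, adj u v → adj v u) {T : Finset V} {u v : V} (h : Reach adj T u v) :
    Reach adj T v u := by
  unfold Reach at h
  induction h with
  | refl => exact Relation.ReflTransGen.refl
  | tail _ hbc ih => exact Relation.ReflTransGen.head ⟨hs _ _ hbc.1, hbc.2.2, hbc.2.1⟩ ih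

theorem Reach.mono {S T : Finset V} (hST : S ⊆ T) {u v : V} (h : Reach adj S u v) :
    Reach adj T u v := by
  unfold Reach at h
  induction h with
  | refl => exact Relation.ReflTransGen.refl
  | tail _ hbc ih => exact ih.tail ⟨hbc.1, hST hbc.2.1, hST hbc.2.2⟩

theorem connSet_of_root (hs : ∀ u v, adj u v → adj v u) {T : Finset V} {a : V} (ha : a ∈ T)
    (h : ∀ v ∈ T, Reach adj T a v) : ConnSet adj T :=
  ⟨⟨a, ha⟩, fun u hu v hv => ((h u hu).symm hs).trans (h v hv)⟩

theorem connSet_singleton (a : V) : ConnSet adj {a} :=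
  ⟨⟨a, by simp⟩, fun u hu v hv => by
    rw [Finset.mem_singleton] at hu hv
    subst hu; subst hv
    exact Relation.ReflTransGen.refl⟩

theorem ConnSet.spread {T : Finset V} (hT : ConnSet adj T) {P : V → Prop} {a : V} (ha : a ∈ T)
    (hPa : P a) (h : ∀ u ∈ T, ∀ v ∈ T, adj u v → P u → P v) : ∀ b ∈ T, P b := by
  intro b hb
  have := hT.2 a ha b hb
  unfold Reach at this
  induction this with
  | refl => exact hPa
  | tail _ hbc ih => exact h _ hbc.2.1 _ hbc.2.2 hbc.1 (ih hbc.2.1)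

theorem ConnSet.insert (hs : ∀ u v, adj u v → adj v u) {T : Finset V} (hT : ConnSet adj T) {u v : V}
    (hu : u ∈ T) (huv : adj u v) : ConnSet adj (insert v T) := by
  refine connSet_of_root hs (Finset.mem_insert_of_mem hu) fun w hw => ?_
  rcases Finset.mem_insert.1 hw with rfl | hw
  · exact Relation.ReflTransGen.single
      ⟨huv, Finset.mem_insert_of_mem hu, Finset.mem_insert_self _ _⟩
  · exact (hT.2 u hu w hw).mono (Finset.subset_insert _ _)

theorem exists_isComp (hs : ∀ u v, adj u v → adj v u) {W X : Finset V} {a : V} (ha : a ∈ W) (haX : a ∉ X) :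
    ∃ K, IsComp adj W X K ∧ a ∈ K := by
  have haWX : a ∈ W \ X := Finset.mem_sdiff.2 ⟨ha, haX⟩
  let K := (W \ X).filter fun v => Reach adj (W \ X) a v
  have haK : a ∈ K := Finset.mem_filter.2 ⟨haWX, Relation.ReflTransGen.refl⟩
  refine ⟨K, ⟨fun v hv => ?_, ?_, ?_, ?_⟩, haK⟩
  · exact (Finset.mem_sdiff.1 (Finset.mem_filter.1 hv).1).1
  · exact Finset.disjoint_left.2 fun v hv => (Finset.mem_sdiff.1 (Finset.mem_filter.1 hv).1).2
  · refine connSet_of_root hs haK fun v hv => ?_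
    have h := (Finset.mem_filter.1 hv).2
    clear hv
    unfold Reach at h
    induction h with
    | refl => exact Relation.ReflTransGen.refl
    | tail hab hbc ih =>
      exact ih.tail ⟨hbc.1, Finset.mem_filter.2 ⟨hbc.2.1, hab⟩,
        Finset.mem_filter.2 ⟨hbc.2.2, hab.tail hbc⟩⟩
  · intro u hu v hv huv hvX
    have hvWX : v ∈ W \ X := Finset.mem_sdiff.2 ⟨hv, hvX⟩
    have hu := Finset.mem_filter.1 hu
    exact Finset.mem_filter.2 ⟨hvWX, hu.2.tail ⟨huv, hu.1, hvWX⟩⟩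

theorem IsComp.absorb {W X K F : Finset V} (hK : IsComp adj W X K) (hF : ConnSet adj F)
    (hFW : F ⊆ W) (hFX : Disjoint F X) {a : V} (haF : a ∈ F) (haK : a ∈ K) : F ⊆ K :=
  hF.spread haF haK fun u _ v hv huv huK =>
    hK.2.2.2 u huK v (hFW hv) huv (Finset.disjoint_left.1 hFX hv)

/-- Either a small connected subset of `K` meets all of `A 0, …, A 4`, or a small subset of `K`
separates these sets. -/
theorem exists_connSet_or_cut (hs : ∀ u v, adj u v → adj v u) (K : Finset V) (A : ℕ → Finset V) {r : ℕ}
    (hr : 0 < r) :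
    (∃ T ⊆ K, ConnSet adj T ∧ T.card ≤ r ∧ ∀ i < 5, ∃ a ∈ T, a ∈ A i) ∨
    ∃ Z ⊆ K, Z.card * r ≤ 5 * K.card ∧ ∀ F ⊆ K, ConnSet adj F → Disjoint F Z →
      ∃ i < 5, ∀ a ∈ F, a ∉ A i := by
  let P : ℕ → V → ℕ → Prop := fun d v i =>
    ∃ T ⊆ K, ConnSet adj T ∧ v ∈ T ∧ T.card ≤ d ∧ ∀ j ≤ i, ∃ a ∈ T, a ∈ A j
  by_cases hP : ∃ v, P r v 4
  · obtain ⟨v, T, hTK, hT, -, hTr, hTA⟩ := hP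
    exact Or.inl ⟨T, hTK, hT, hTr, fun i hi => hTA i (by omega)⟩
  right
  have hmono : ∀ {d d' v i}, d ≤ d' → P d v i → P d' v i := by
    rintro d d' v i hdd ⟨T, h1, h2, h3, h4, h5⟩
    exact ⟨T, h1, h2, h3, h4.trans hdd, h5⟩
  let L : ℕ → Finset (V × ℕ) := fun d =>
    (K ×ˢ Finset.range 5).filter fun p => P d p.1 p.2 ∧ ¬ P (d - 1) p.1 p.2
  have hdisj : ∀ d ∈ Finset.Icc 1 r, ∀ d' ∈ Finset.Icc 1 r, d ≠ d' → Disjoint (L d) (L d') := by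
    have key : ∀ d d', d < d' → Disjoint (L d) (L d') := fun d d' hlt =>
      Finset.disjoint_left.2 fun p hp hp' =>
        (Finset.mem_filter.1 hp').2.2
          (hmono (show d ≤ d' - 1 by omega) (Finset.mem_filter.1 hp).2.1)
    intro d _ d' _ hne
    rcases lt_or_gt_of_ne hne with h | h
    · exact key _ _ h
    · exact (key _ _ h).symm
  have hsum : ∑ d ∈ Finset.Icc 1 r, (L d).card ≤ 5 * K.card := by
    rw [← Finset.card_biUnion hdisj]
    calc _ ≤ (K ×ˢ Finset.range 5).card :=
          Finset.card_le_card (Finset.biUnion_subset.2 fun d _ => Finset.filter_subset _ _)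
      _ = 5 * K.card := by rw [Finset.card_product, Finset.card_range, mul_comm]
  obtain ⟨d, hd, hdL⟩ : ∃ d ∈ Finset.Icc 1 r, (L d).card * r ≤ 5 * K.card := by
    by_contra! hcon
    have hne : (Finset.Icc 1 r).Nonempty := ⟨1, Finset.mem_Icc.2 ⟨le_rfl, hr⟩⟩
    have := Finset.sum_lt_sum_of_nonempty hne hcon
    rw [Finset.sum_const, Nat.card_Icc, smul_eq_mul, ← Finset.sum_mul] at this
    have h2 := Nat.mul_le_mul_right r hsum
    rw [Nat.add_sub_cancel] at this
    refine absurd h2 (not_le.2 (lt_of_eq_of_lt ?_ this))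
    ring
  rw [Finset.mem_Icc] at hd
  refine ⟨(L d).image Prod.fst, fun v hv => ?_, ?_, fun F hFK hF hFZ => ?_⟩
  · obtain ⟨p, hp, rfl⟩ := Finset.mem_image.1 hv
    exact (Finset.mem_product.1 (Finset.mem_filter.1 hp).1).1
  · exact (Nat.mul_le_mul_right r Finset.card_image_le).trans hdL
  by_contra! hcon
  have hdrop : ∀ v ∈ F, ∀ i < 5, P d v i → P (d - 1) v i := by
    intro v hv i hi hPd
    by_contra hPd'
    exact Finset.disjoint_left.1 hFZ hv (Finset.mem_image.2 ⟨(v, i), Finset.mem_filter.2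
      ⟨Finset.mem_product.2 ⟨hFK hv, Finset.mem_range.2 hi⟩, hPd, hPd'⟩, rfl⟩)
  have hspread : ∀ i < 5, ∀ a ∈ F, P (d - 1) a i → ∀ v ∈ F, P (d - 1) v i := by
    intro i hi a ha hPa
    refine hF.spread (P := fun v => P (d - 1) v i) ha hPa ?_
    rintro u hu v hv huv ⟨T, hTK, hT, huT, hTc, hTA⟩
    refine hdrop v hv i hi ⟨insert v T, Finset.insert_subset (hFK hv) hTK, hT.insert hs huT huv,
      Finset.mem_insert_self _ _, ?_, fun j hj => ?_⟩
    · have := Finset.card_insert_le v T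
      omega
    · obtain ⟨a, ha, haA⟩ := hTA j hj
      exact ⟨a, Finset.mem_insert_of_mem ha, haA⟩
  have hall : ∀ i < 5, ∀ v ∈ F, P (d - 1) v i := by
    intro i
    induction i with
    | zero =>
      intro hi
      obtain ⟨a, haF, haA⟩ := hcon 0 hi
      refine hspread 0 hi a haF (hdrop a haF 0 hi ⟨{a}, by simpa using hFK haF,
        connSet_singleton a, by simp, by simpa using hd.1, fun j hj => ⟨a, by simp, ?_⟩⟩)
      rwa [Nat.le_zero.1 hj]
    | succ i ih =>
      intro hi
      obtain ⟨a, haF, haA⟩ := hcon (i + 1) hi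
      obtain ⟨T, hTK, hT, haT, hTc, hTA⟩ := ih (by omega) a haF
      refine hspread (i + 1) hi a haF ⟨T, hTK, hT, haT, hTc, fun j hj => ?_⟩
      rcases Nat.lt_or_ge i j with h | h
      · obtain rfl : j = i + 1 := by omega
        exact ⟨a, haT, haA⟩
      · exact hTA j h
  obtain ⟨a, ha⟩ := hF.1
  exact hP ⟨a, hmono (by omega) (hall 4 (by omega) a ha)⟩

/-- The subsets `A` and `B` of `W` are separated by `Z`. -/
def IsSeparation (adj : V → V → Prop) (W A B Z : Finset V) : Prop :=
  W = A ∪ B ∪ Z ∧ Disjoint A B ∧ Disjoint A Z ∧ Disjoint B Z ∧ ∀ u ∈ A, ∀ v ∈ B, ¬ adj u v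

/-- If no balanced separation by `X` exists, some component of `W \ X` is large. -/
theorem exists_big_isComp (hs : ∀ u v, adj u v → adj v u) {W X : Finset V} (hXW : X ⊆ W)
    (h : ∀ A B, IsSeparation adj W A B X → 3 * A.card ≤ 2 * W.card →
      2 * W.card < 3 * B.card) :
    ∃ K, IsComp adj W X K ∧ W.card < 2 * K.card := by
  let F := (W \ X).powerset.filter fun A =>
    (∀ u ∈ A, ∀ v ∈ (W \ X) \ A, ¬ adj u v) ∧ 3 * A.card ≤ 2 * W.card
  have hF : F.Nonempty := ⟨∅, by simp [F]⟩
  obtain ⟨A, hA, hmax⟩ := F.exists_max_image Finset.card hF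
  obtain ⟨hAW, hAadj, hAc⟩ : A ⊆ W \ X ∧ _ ∧ _ := by simpa [F] using hA
  have hAadj' : ∀ u ∈ A, ∀ v ∈ (W \ X) \ A, ¬ adj u v := (Finset.mem_filter.1 hA).2.1
  have hsep : IsSeparation adj W A ((W \ X) \ A) X := by
    refine ⟨?_, Finset.disjoint_sdiff, ?_, ?_, hAadj'⟩
    · rw [Finset.union_sdiff_of_subset hAW, Finset.sdiff_union_of_subset hXW]
    · exact Finset.disjoint_of_subset_left hAW Finset.sdiff_disjoint
    · exact Finset.disjoint_of_subset_left Finset.sdiff_subset Finset.sdiff_disjoint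
  have hB := h _ _ hsep hAc
  have hc1 := Finset.card_sdiff_add_card_eq_card hAW
  have hc2 := Finset.card_sdiff_add_card_eq_card hXW
  obtain ⟨b, hb⟩ : ((W \ X) \ A).Nonempty := Finset.card_pos.1 (by omega)
  have hbWX := Finset.mem_sdiff.1 (Finset.mem_sdiff.1 hb).1
  obtain ⟨K, hK, hbK⟩ := exists_isComp hs hbWX.1 hbWX.2
  refine ⟨K, hK, ?_⟩
  have hKA : Disjoint A K := by
    rw [Finset.disjoint_right]
    refine hK.2.2.1.spread hbK (Finset.mem_sdiff.1 hb).2 fun u hu v hv huv huA hvA => ?_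
    refine hAadj' v hvA u (Finset.mem_sdiff.2 ⟨Finset.mem_sdiff.2 ⟨hK.1 hu, ?_⟩, huA⟩) (hs _ _ huv)
    exact Finset.disjoint_left.1 hK.2.1 hu
  by_contra hcon
  have hcard := Finset.card_union_of_disjoint hKA
  have hKpos := Finset.card_pos.2 hK.2.2.1.1
  have hKmem : 3 * K.card ≤ 2 * W.card → K ∈ F := fun hle => by
    refine Finset.mem_filter.2 ⟨Finset.mem_powerset.2 (Finset.subset_sdiff.2 ⟨hK.1, hK.2.1⟩), ?_, hle⟩
    intro u hu v hv huv
    simp only [Finset.mem_sdiff] at hv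
    exact hv.2 (hK.2.2.2 u hu v hv.1.1 huv hv.1.2)
  have hKA := hmax _ (hKmem (by omega))
  have hmem : A ∪ K ∈ F := by
    refine Finset.mem_filter.2 ⟨Finset.mem_powerset.2 (Finset.union_subset hAW ?_), ?_, by omega⟩
    · exact Finset.subset_sdiff.2 ⟨hK.1, hK.2.1⟩
    · intro u hu v hv huv
      simp only [Finset.mem_sdiff, Finset.mem_union, not_or] at hv
      rcases Finset.mem_union.1 hu with hu | hu
      · exact hAadj' u hu v (Finset.mem_sdiff.2 ⟨Finset.mem_sdiff.2 hv.1, hv.2.1⟩) huv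
      · exact hv.2.2 (hK.2.2.2 u hu v hv.1.1 huv hv.1.2)
  have := hmax _ hmem
  omega

/-- A `K₅`-minor model under construction: disjoint, pairwise adjacent connected sets `C i`
(`i ∈ I`), each avoiding the large component `K` of `W` minus the small sets `x i ⊆ C i`. -/
structure Covey (adj : V → V → Prop) (W : Finset V) (r : ℕ) (I : Finset (Fin 5))
    (C x : Fin 5 → Finset V) (K : Finset V) : Prop where
  conn : ∀ i ∈ I, ConnSet adj (C i)
  subset : ∀ i ∈ I, C i ⊆ W
  trace_subset : ∀ i ∈ I, x i ⊆ C i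
  card_trace : ∀ i ∈ I, (x i).card ≤ r
  disjoint_comp : ∀ i ∈ I, Disjoint (C i) K
  disjoint : ∀ i ∈ I, ∀ j ∈ I, i ≠ j → Disjoint (C i) (C j)
  touch : ∀ i ∈ I, ∀ j ∈ I, i ≠ j → ∃ u ∈ C i, ∃ v ∈ C j, adj u v
  comp : IsComp adj W (I.biUnion x) K
  big : W.card < 2 * K.card

theorem Covey.card_biUnion_le {W : Finset V} {r : ℕ} {I : Finset (Fin 5)}
    {C x : Fin 5 → Finset V} {K : Finset V} (h : Covey adj W r I C x K) :
    (I.biUnion x).card ≤ I.card * r :=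
  Finset.card_biUnion_le_card_mul _ _ _ h.card_trace

theorem inter_of_big {W K K' : Finset V} (hK : K ⊆ W) (hK' : K' ⊆ W) (h : W.card < 2 * K.card)
    (h' : W.card < 2 * K'.card) : ∃ a, a ∈ K ∧ a ∈ K' := by
  by_contra! hcon
  have := Finset.card_union_of_disjoint (Finset.disjoint_left.2 hcon)
  have := Finset.card_le_card (Finset.union_subset hK hK')
  omega


theorem Covey.not_of_noK5 (hs : ∀ u v, adj u v → adj v u) (hK5 : NoK5 adj) {W : Finset V} {r : ℕ}
    (hr : 0 < r) (hrW : 5 * W.card ≤ r * r)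
    (hbig : ∀ X ⊆ W, X.card ≤ 5 * r → ∃ K, IsComp adj W X K ∧ W.card < 2 * K.card) (m : ℕ) :
    ∀ I C x K, Covey adj W r I C x K → 6 * K.card + I.card = m → False := by
  induction m using Nat.strong_induction_on with
  | _ m ih =>
  intro I C x K h hm
  have hIuniv : I ≠ Finset.univ := by
    rintro rfl
    exact hK5 ⟨C, fun i => h.conn i (Finset.mem_univ i),
      fun i j hij => h.disjoint i (Finset.mem_univ i) j (Finset.mem_univ j) hij,
      fun i j hij => h.touch i (Finset.mem_univ i) j (Finset.mem_univ j) hij⟩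
  obtain ⟨j, hj⟩ : ∃ j, j ∉ I := by
    by_contra! hcon
    exact hIuniv (Finset.eq_univ_iff_forall.2 hcon)
  have hIcard : I.card ≤ 4 := by
    have := Finset.card_lt_univ_of_notMem hj
    rw [Fintype.card_fin] at this
    omega
  have hxW : ∀ i ∈ I, x i ⊆ W := fun i hi => (h.trace_subset i hi).trans (h.subset i hi)
  have hXW : I.biUnion x ⊆ W := Finset.biUnion_subset.2 hxW
  have hXcard : (I.biUnion x).card ≤ 4 * r :=
    h.card_biUnion_le.trans (Nat.mul_le_mul_right r hIcard)
  set X := I.biUnion x with hXdef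
  have hKX : ∀ v ∈ K, v ∉ X := fun v hv => Finset.disjoint_left.1 h.comp.2.1 hv
  let A : Fin 5 → Finset V := fun i => if i ∈ I then K.filter fun v => ∃ c ∈ C i, adj c v else K
  have hA : ∀ i ∈ I, ∀ v, v ∈ A i ↔ v ∈ K ∧ ∃ c ∈ C i, adj c v := by
    intro i hi v
    simp [A, hi]
  by_cases hempty : ∃ i ∈ I, A i = ∅
  · obtain ⟨i, hi, hAi⟩ := hempty
    have hsub := Finset.erase_subset i I
    have hlt := Finset.card_erase_lt_of_mem hi
    refine ih (6 * K.card + (I.erase i).card) (by omega) (I.erase i) C x K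
      ⟨fun l hl => h.conn l (hsub hl), fun l hl => h.subset l (hsub hl),
       fun l hl => h.trace_subset l (hsub hl), fun l hl => h.card_trace l (hsub hl),
       fun l hl => h.disjoint_comp l (hsub hl),
       fun l hl l' hl' => h.disjoint l (hsub hl) l' (hsub hl'),
       fun l hl l' hl' => h.touch l (hsub hl) l' (hsub hl'), ⟨h.comp.1, ?_, h.comp.2.2.1, ?_⟩,
       h.big⟩ rfl
    · exact Finset.disjoint_of_subset_right (Finset.biUnion_subset_biUnion_of_subset_left _ hsub)
        h.comp.2.1
    · intro u hu v hv huv hvX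
      refine h.comp.2.2.2 u hu v hv huv fun hvX' => ?_
      obtain ⟨l, hl, hvl⟩ := Finset.mem_biUnion.1 hvX'
      have hli : l = i := by
        by_contra hne
        exact hvX (Finset.mem_biUnion.2 ⟨l, Finset.mem_erase.2 ⟨hne, hl⟩, hvl⟩)
      subst hli
      have : u ∈ A l := (hA l hl u).2 ⟨hu, v, h.trace_subset l hl hvl, hs _ _ huv⟩
      rw [hAi] at this
      exact absurd this (Finset.notMem_empty u)
  push Not at hempty
  let A' : ℕ → Finset V := fun n => if hn : n < 5 then A ⟨n, hn⟩ else ∅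
  have hA' : ∀ i : Fin 5, A' i = A i := fun i => by simp [A']
  rcases exists_connSet_or_cut hs K A' hr with ⟨T, hTK, hT, hTr, hTA⟩ | ⟨Z, hZK, hZr, hZ⟩
  · -- a new set can be added to the model
    have hXT : X ∪ T ⊆ W := Finset.union_subset hXW (hTK.trans h.comp.1)
    obtain ⟨K', hK', hK'big⟩ := hbig (X ∪ T) hXT
      ((Finset.card_union_le _ _).trans (by omega))
    have hK'X : Disjoint K' X := Finset.disjoint_of_subset_right Finset.subset_union_left hK'.2.1
    have hK'T : Disjoint K' T := Finset.disjoint_of_subset_right Finset.subset_union_right hK'.2.1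
    obtain ⟨a, haK, haK'⟩ := inter_of_big h.comp.1 hK'.1 h.big hK'big
    have hK'K : K' ⊆ K := h.comp.absorb hK'.2.2.1 hK'.1 hK'X haK' haK
    have hlt : K'.card < K.card := by
      obtain ⟨t, ht⟩ := hT.1
      exact Finset.card_lt_card ⟨hK'K, fun hsub =>
        Finset.disjoint_right.1 hK'T ht (hsub (hTK ht))⟩
    have hne : ∀ i ∈ I, i ≠ j := fun i hi hij => hj (hij ▸ hi)
    have hCu : ∀ i ∈ I, Function.update C j T i = C i := fun i hi =>
      Function.update_of_ne (hne i hi) _ _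
    have hxu : ∀ i ∈ I, Function.update x j T i = x i := fun i hi =>
      Function.update_of_ne (hne i hi) _ _
    have hCT : ∀ i ∈ I, Disjoint (C i) T := fun i hi =>
      Finset.disjoint_of_subset_right hTK (h.disjoint_comp i hi)
    have htouch : ∀ i ∈ I, ∃ u ∈ C i, ∃ v ∈ T, adj u v := fun i hi => by
      obtain ⟨a, haT, haA⟩ := hTA i i.2
      rw [hA' i, hA i hi] at haA
      obtain ⟨-, c, hc, hca⟩ := haA
      exact ⟨c, hc, a, haT, hca⟩
    have hcard := Finset.card_insert_of_notMem hj
    refine ih (6 * K'.card + (insert j I).card) (by omega) (insert j I) (Function.update C j T)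
      (Function.update x j T) K' ⟨?_, ?_, ?_, ?_, ?_, ?_, ?_, ?_, hK'big⟩ rfl
    · rw [Finset.forall_mem_insert, Function.update_self]
      exact ⟨hT, fun i hi => by rw [hCu i hi]; exact h.conn i hi⟩
    · rw [Finset.forall_mem_insert, Function.update_self]
      exact ⟨hTK.trans h.comp.1, fun i hi => by rw [hCu i hi]; exact h.subset i hi⟩
    · rw [Finset.forall_mem_insert, Function.update_self, Function.update_self]
      exact ⟨subset_rfl, fun i hi => by rw [hCu i hi, hxu i hi]; exact h.trace_subset i hi⟩
    · rw [Finset.forall_mem_insert, Function.update_self]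
      exact ⟨hTr, fun i hi => by rw [hxu i hi]; exact h.card_trace i hi⟩
    · rw [Finset.forall_mem_insert, Function.update_self]
      exact ⟨hK'T.symm, fun i hi => by
        rw [hCu i hi]; exact Finset.disjoint_of_subset_right hK'K (h.disjoint_comp i hi)⟩
    · intro i hi l hl hil
      rcases Finset.mem_insert.1 hi with rfl | hi' <;> rcases Finset.mem_insert.1 hl with rfl | hl'
      · exact absurd rfl hil
      · rw [Function.update_self, hCu l hl']; exact (hCT l hl').symm
      · rw [Function.update_self, hCu i hi']; exact hCT i hi'
      · rw [hCu i hi', hCu l hl']; exact h.disjoint i hi' l hl' hil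
    · intro i hi l hl hil
      rcases Finset.mem_insert.1 hi with rfl | hi' <;> rcases Finset.mem_insert.1 hl with rfl | hl'
      · exact absurd rfl hil
      · rw [Function.update_self, hCu l hl']
        obtain ⟨u, hu, v, hv, huv⟩ := htouch l hl'
        exact ⟨v, hv, u, hu, hs _ _ huv⟩
      · rw [Function.update_self, hCu i hi']; exact htouch i hi'
      · rw [hCu i hi', hCu l hl']; exact h.touch i hi' l hl' hil
    · have : (insert j I).biUnion (Function.update x j T) = X ∪ T := by
        rw [Finset.biUnion_insert, Function.update_self, Finset.union_comm,
          Finset.biUnion_congr rfl hxu]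
      rwa [this]
  · -- some set of the model can be enlarged so as to cut off part of `K`
    have hZcard : Z.card ≤ r := by
      have h1 := Finset.card_le_card h.comp.1
      exact Nat.le_of_mul_le_mul_right (hZr.trans ((Nat.mul_le_mul_left 5 h1).trans hrW)) hr
    have hXZ : X ∪ Z ⊆ W := Finset.union_subset hXW (hZK.trans h.comp.1)
    obtain ⟨K', hK', hK'big⟩ := hbig (X ∪ Z) hXZ
      ((Finset.card_union_le _ _).trans (by omega))
    have hK'X : Disjoint K' X := Finset.disjoint_of_subset_right Finset.subset_union_left hK'.2.1
    have hK'Z : Disjoint K' Z := Finset.disjoint_of_subset_right Finset.subset_union_right hK'.2.1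
    obtain ⟨a, haK, haK'⟩ := inter_of_big h.comp.1 hK'.1 h.big hK'big
    have hK'K : K' ⊆ K := h.comp.absorb hK'.2.2.1 hK'.1 hK'X haK' haK
    obtain ⟨i, hiA⟩ : ∃ i : Fin 5, ∀ a ∈ K', a ∉ A i := by
      obtain ⟨n, hn, hnA⟩ := hZ K' hK'K hK'.2.2.1 hK'Z
      exact ⟨⟨n, hn⟩, fun a ha => by rw [← hA']; exact hnA a ha⟩
    have hi : i ∈ I := by
      by_contra hi
      exact hiA a haK' (by simpa [A, hi] using haK)
    have hAne := hempty i hi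
    let R := (K \ K').filter fun v => ∃ b ∈ A i, b ∈ K \ K' ∧ Reach adj (K \ K') b v
    have hRK : R ⊆ K \ K' := Finset.filter_subset _ _
    have hAR : A i ⊆ R := fun b hb => by
      have : b ∈ K \ K' := Finset.mem_sdiff.2 ⟨((hA i hi b).1 hb).1, fun hb' => hiA b hb' hb⟩
      exact Finset.mem_filter.2 ⟨this, b, hb, this, Relation.ReflTransGen.refl⟩
    have hRstep : ∀ u ∈ R, ∀ v ∈ K, v ∉ K' → adj u v → v ∈ R := by
      intro u hu v hv hvK' huv
      obtain ⟨huK, b, hb, hbK, hbu⟩ := Finset.mem_filter.1 hu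
      have hvKK : v ∈ K \ K' := Finset.mem_sdiff.2 ⟨hv, hvK'⟩
      exact Finset.mem_filter.2 ⟨hvKK, b, hb, hbK, hbu.tail ⟨huv, huK, hvKK⟩⟩
    let X' := (I.erase i).biUnion x ∪ (Z ∩ R)
    have hX'X : X' ⊆ X ∪ Z := Finset.union_subset_union
      (Finset.biUnion_subset_biUnion_of_subset_left _ (Finset.erase_subset i I))
      Finset.inter_subset_left
    obtain ⟨K'', hK'', hK''big⟩ := hbig X' (hX'X.trans hXZ)
      ((Finset.card_le_card hX'X).trans ((Finset.card_union_le _ _).trans (by omega)))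
    obtain ⟨b, hbK'', hbK'⟩ := inter_of_big hK''.1 hK'.1 hK''big hK'big
    have hK''R : ∀ v ∈ K'', v ∈ K ∧ v ∉ R := by
      refine hK''.2.2.1.spread hbK'' ⟨hK'K hbK', fun hbR => (Finset.mem_sdiff.1 (hRK hbR)).2 hbK'⟩ ?_
      rintro u hu v hv huv ⟨huK, huR⟩
      have hvX' : v ∉ X' := Finset.disjoint_left.1 hK''.2.1 hv
      have hvK : v ∈ K := by
        refine h.comp.2.2.2 u huK v (hK''.1 hv) huv fun hvX => ?_
        obtain ⟨l, hl, hvl⟩ := Finset.mem_biUnion.1 hvX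
        rcases eq_or_ne l i with rfl | hne
        · exact huR (hAR ((hA l hl u).2 ⟨huK, v, h.trace_subset l hl hvl, hs _ _ huv⟩))
        · exact hvX' (Finset.mem_union_left _
            (Finset.mem_biUnion.2 ⟨l, Finset.mem_erase.2 ⟨hne, hl⟩, hvl⟩))
      refine ⟨hvK, fun hvR => ?_⟩
      by_cases huK' : u ∈ K'
      · have hvK' := (Finset.mem_sdiff.1 (hRK hvR)).2
        have hvXZ : v ∈ X ∪ Z := by
          by_contra hvXZ
          exact hvK' (hK'.2.2.2 u huK' v (hK''.1 hv) huv hvXZ)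
        rcases Finset.mem_union.1 hvXZ with hvX | hvZ
        · exact hKX v hvK hvX
        · exact hvX' (Finset.mem_union_right _ (Finset.mem_inter.2 ⟨hvZ, hvR⟩))
      · exact huR (hRstep v hvR u huK huK' (hs _ _ huv))
    have hlt : K''.card < K.card := by
      obtain ⟨c, hc⟩ := hAne
      refine Finset.card_lt_card ⟨fun v hv => (hK''R v hv).1, fun hsub => ?_⟩
      exact (hK''R c (hsub (Finset.mem_sdiff.1 (hRK (hAR hc))).1)).2 (hAR hc)
    have hRW : R ⊆ W := hRK.trans (Finset.sdiff_subset.trans h.comp.1)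
    have hCu : ∀ l, l ≠ i → Function.update C i (C i ∪ R) l = C l := fun l hl =>
      Function.update_of_ne hl _ _
    have hxu : ∀ l, l ≠ i → Function.update x i (Z ∩ R) l = x l := fun l hl =>
      Function.update_of_ne hl _ _
    have hCR : ∀ l ∈ I, Disjoint (C l) R := fun l hl =>
      Finset.disjoint_of_subset_right (hRK.trans Finset.sdiff_subset) (h.disjoint_comp l hl)
    have hCsub : ∀ l, C l ⊆ Function.update C i (C i ∪ R) l := fun l => by
      rcases eq_or_ne l i with rfl | hne
      · rw [Function.update_self]; exact Finset.subset_union_left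
      · rw [hCu l hne]
    refine ih (6 * K''.card + I.card) (by omega) I (Function.update C i (C i ∪ R))
      (Function.update x i (Z ∩ R)) K'' ⟨?_, ?_, ?_, ?_, ?_, ?_, ?_, ?_, hK''big⟩ rfl
    · intro l hl
      rcases eq_or_ne l i with rfl | hne
      · rw [Function.update_self]
        obtain ⟨c, hc⟩ := (h.conn l hl).1
        refine connSet_of_root hs (Finset.mem_union_left _ hc) fun v hv => ?_
        rcases Finset.mem_union.1 hv with hv | hv
        · exact ((h.conn l hl).2 c hc v hv).mono Finset.subset_union_left
        obtain ⟨hvK, b, hbA, hbK, hbv⟩ := Finset.mem_filter.1 hv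
        obtain ⟨-, d, hd, hdb⟩ := (hA l hl b).1 hbA
        have h1 : Reach adj (C l ∪ R) c d :=
          ((h.conn l hl).2 c hc d hd).mono Finset.subset_union_left
        have h2 := h1.tail ⟨hdb, Finset.mem_union_left _ hd, Finset.mem_union_right _ (hAR hbA)⟩
        refine h2.trans ?_
        clear hv
        unfold Reach at hbv
        induction hbv with
        | refl => exact Relation.ReflTransGen.refl
        | tail hbc hcd ih =>
          have hmem := Finset.mem_union_right (C l)
            (Finset.mem_filter.2 ⟨hcd.2.1, b, hbA, hbK, hbc⟩ : _ ∈ R)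
          refine (ih hmem hcd.2.1).tail ⟨hcd.1, hmem, ?_⟩
          exact Finset.mem_union_right _
            (Finset.mem_filter.2 ⟨hcd.2.2, b, hbA, hbK, hbc.tail hcd⟩)
      · rw [hCu l hne]; exact h.conn l hl
    · intro l hl
      rcases eq_or_ne l i with rfl | hne
      · rw [Function.update_self]; exact Finset.union_subset (h.subset l hl) hRW
      · rw [hCu l hne]; exact h.subset l hl
    · intro l hl
      rcases eq_or_ne l i with rfl | hne
      · rw [Function.update_self, Function.update_self]
        exact Finset.inter_subset_right.trans Finset.subset_union_right
      · rw [hCu l hne, hxu l hne]; exact h.trace_subset l hl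
    · intro l hl
      rcases eq_or_ne l i with rfl | hne
      · rw [Function.update_self]
        exact (Finset.card_le_card Finset.inter_subset_left).trans hZcard
      · rw [hxu l hne]; exact h.card_trace l hl
    · intro l hl
      have hd : Disjoint (C l) K'' :=
        Finset.disjoint_of_subset_right (fun v hv => (hK''R v hv).1) (h.disjoint_comp l hl)
      rcases eq_or_ne l i with rfl | hne
      · rw [Function.update_self]
        exact Finset.disjoint_union_left.2 ⟨hd, Finset.disjoint_right.2 fun v hv => (hK''R v hv).2⟩
      · rw [hCu l hne]; exact hd
    · intro l hl l' hl' hll'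
      rcases eq_or_ne l i with rfl | hne
      · rw [Function.update_self, hCu l' hll'.symm]
        exact Finset.disjoint_union_left.2 ⟨h.disjoint l hl l' hl' hll', (hCR l' hl').symm⟩
      · rw [hCu l hne]
        rcases eq_or_ne l' i with rfl | hne'
        · rw [Function.update_self]
          exact Finset.disjoint_union_right.2 ⟨h.disjoint l hl l' hl' hll', hCR l hl⟩
        · rw [hCu l' hne']; exact h.disjoint l hl l' hl' hll'
    · intro l hl l' hl' hll'
      obtain ⟨u, hu, v, hv, huv⟩ := h.touch l hl l' hl' hll'
      exact ⟨u, hCsub l hu, v, hCsub l' hv, huv⟩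
    · have : I.biUnion (Function.update x i (Z ∩ R)) = X' := by
        conv_lhs => rw [← Finset.insert_erase hi]
        rw [Finset.biUnion_insert, Function.update_self, Finset.union_comm,
          Finset.biUnion_congr rfl fun l hl => hxu l (Finset.ne_of_mem_erase hl)]
      rwa [this]

/-- Balanced separators of order `O(√n)` in graphs without a `K₅` minor
(Alon, Seymour and Thomas). -/
theorem exists_isSeparation (hs : ∀ u v, adj u v → adj v u) (hK5 : NoK5 adj) {W : Finset V} {r : ℕ}
    (hr : 0 < r) (hrW : 5 * W.card ≤ r * r) :
    ∃ A B Z, IsSeparation adj W A B Z ∧ Z.card ≤ 5 * r ∧ 3 * A.card ≤ 2 * W.card ∧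
      3 * B.card ≤ 2 * W.card := by
  by_contra! hcon
  have hbig : ∀ X ⊆ W, X.card ≤ 5 * r → ∃ K, IsComp adj W X K ∧ W.card < 2 * K.card :=
    fun X hXW hX => exists_big_isComp hs hXW fun A B hAB hA => hcon A B X hAB hX hA
  obtain ⟨K, hK, hKbig⟩ := hbig ∅ (Finset.empty_subset W) (by simp)
  refine Covey.not_of_noK5 hs hK5 hr hrW hbig _ ∅ (fun _ => ∅) (fun _ => ∅) K ?_ rfl
  exact ⟨by simp, by simp, by simp, by simp, by simp, by simp, by simp, by simpa using hK, hKbig⟩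

theorem exists_isSeparation_sqrt (hs : ∀ u v, adj u v → adj v u) (hK5 : NoK5 adj) {W : Finset V}
    (hW : W.Nonempty) :
    ∃ A B Z, IsSeparation adj W A B Z ∧ (Z.card : ℝ) ≤ 17 * √(W.card : ℝ) ∧
      3 * A.card ≤ 2 * W.card ∧ 3 * B.card ≤ 2 * W.card := by
  obtain ⟨A, B, Z, h, hZ, hA, hB⟩ := exists_isSeparation hs hK5
    (W := W) (r := Nat.sqrt (5 * W.card) + 1) (Nat.succ_pos _) (Nat.lt_succ_sqrt _).le
  refine ⟨A, B, Z, h, ?_, hA, hB⟩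
  have h1 : (Z.card : ℝ) ≤ 5 * (Nat.sqrt (5 * W.card) + 1) := by exact_mod_cast hZ
  have hW1 : (1 : ℝ) ≤ W.card := by exact_mod_cast hW.card_pos
  have h2 : (1 : ℝ) ≤ √(W.card : ℝ) := Real.one_le_sqrt.2 hW1
  have h3 : ((Nat.sqrt (5 * W.card) : ℕ) : ℝ) ^ 2 ≤ 5 * W.card := by
    exact_mod_cast Nat.sqrt_le' (5 * W.card)
  have h4 : ((Nat.sqrt (5 * W.card) : ℕ) : ℝ) ≤ 12 / 5 * √(W.card : ℝ) := by
    refine le_of_sq_le_sq ?_ (by positivity)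
    rw [mul_pow, Real.sq_sqrt (by positivity)]
    linarith
  linarith

theorem four_thirds_mul_le {a b s : ℝ} (ha : 0 ≤ a) (hb : 0 ≤ b) (has : s ^ 2 ≤ 4 * a ^ 2)
    (hbs : s ^ 2 ≤ 4 * b ^ 2) (hab : s ^ 2 ≤ a ^ 2 + b ^ 2) : 4 / 3 * s ≤ a + b := by
  have h1 : 3 / 16 * (s ^ 2) ^ 2 ≤ (a * b) ^ 2 := by
    nlinarith [mul_nonneg (sub_nonneg.2 has) (sub_nonneg.2 hbs), sq_nonneg s]
  have h2 : 2 / 5 * s ^ 2 ≤ a * b := by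
    refine le_of_sq_le_sq ?_ (by positivity)
    nlinarith [sq_nonneg (s ^ 2)]
  refine le_of_sq_le_sq ?_ (by positivity)
  nlinarith [sq_nonneg s]

/-- `D` is a cover of the vertices and edges of the subgraph induced on `W` by sets of size at
most `r`. -/
structure IsDivision (adj : V → V → Prop) (W : Finset V) (r : ℕ) (D : Finset (Finset V)) :
    Prop where
  subset : ∀ P ∈ D, P ⊆ W
  card_le : ∀ P ∈ D, P.card ≤ r
  cover : ∀ v ∈ W, ∃ P ∈ D, v ∈ P
  edge : ∀ u ∈ W, ∀ v ∈ W, adj u v → ∃ P ∈ D, u ∈ P ∧ v ∈ P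

theorem isDivision_singleton {W : Finset V} {r : ℕ} (h : W.card ≤ r) :
    IsDivision adj W r {W} :=
  ⟨by simp, by simpa using h, fun v hv => ⟨W, by simp, hv⟩, fun u hu v hv _ => ⟨W, by simp, hu, hv⟩⟩

theorem exists_isDivision_aux (hs : ∀ u v, adj u v → adj v u) (hK5 : NoK5 adj) {r : ℕ}
    (hr : (204 : ℝ) ≤ √(r : ℝ)) (n : ℕ) :
    ∀ W : Finset V, W.card = n → r ≤ 4 * n → ∃ D, IsDivision adj W r D ∧
      ((∑ P ∈ D, P.card : ℕ) : ℝ) ≤ n * (1 + 204 / √(r : ℝ)) - 102 * √(n : ℝ) := by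
  have hρ : (0 : ℝ) < √(r : ℝ) := by linarith
  have hρ2 : √(r : ℝ) ^ 2 = r := Real.sq_sqrt (by positivity)
  induction n using Nat.strong_induction_on with
  | _ n ih =>
  intro W hWn hrn
  have hs2 : √(n : ℝ) ^ 2 = n := Real.sq_sqrt (by positivity)
  have hs0 : 0 ≤ √(n : ℝ) := Real.sqrt_nonneg _
  rcases le_or_gt n r with hnr | hnr
  · refine ⟨{W}, isDivision_singleton (hWn.trans_le hnr), ?_⟩
    rw [Finset.sum_singleton, hWn]
    have h1 : √(r : ℝ) ≤ 2 * √(n : ℝ) := by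
      refine le_of_sq_le_sq ?_ (by positivity)
      rw [mul_pow, hρ2, hs2]
      norm_num
      exact_mod_cast hrn
    have h2 : 102 * √(n : ℝ) ≤ n * (204 / √(r : ℝ)) := by
      rw [mul_div_assoc', le_div_iff₀ hρ]
      nlinarith
    linarith
  have hrs : √(r : ℝ) ≤ √(n : ℝ) := Real.sqrt_le_sqrt (by exact_mod_cast hnr.le)
  obtain ⟨A, B, Z, ⟨hW, hAB, hAZ, hBZ, hadj⟩, hZ, hA, hB⟩ :=
    exists_isSeparation_sqrt hs hK5 (W := W) (Finset.card_pos.1 (by omega))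
  rw [hWn] at hZ hA hB
  have hcW : n = A.card + B.card + Z.card := by
    rw [← hWn, hW, Finset.card_union_of_disjoint (Finset.disjoint_union_left.2 ⟨hAZ, hBZ⟩),
      Finset.card_union_of_disjoint hAB]
  have hcA := Finset.card_union_of_disjoint hAZ
  have hcB := Finset.card_union_of_disjoint hBZ
  have hZn : 12 * Z.card ≤ n := by
    have : (12 : ℝ) * Z.card ≤ n := by nlinarith
    exact_mod_cast this
  obtain ⟨D, hD, hDs⟩ := ih (A.card + Z.card) (by omega) (A ∪ Z) hcA (by omega)
  obtain ⟨E, hE, hEs⟩ := ih (B.card + Z.card) (by omega) (B ∪ Z) hcB (by omega)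
  have hAW : A ∪ Z ⊆ W := by
    rw [hW]; exact Finset.union_subset_union_left Finset.subset_union_left
  have hBW : B ∪ Z ⊆ W := by
    rw [hW]; exact Finset.union_subset_union_left Finset.subset_union_right
  refine ⟨D ∪ E, ⟨?_, ?_, ?_, ?_⟩, ?_⟩
  · intro P hP
    rcases Finset.mem_union.1 hP with hP | hP
    · exact (hD.subset P hP).trans hAW
    · exact (hE.subset P hP).trans hBW
  · intro P hP
    rcases Finset.mem_union.1 hP with hP | hP
    · exact hD.card_le P hP
    · exact hE.card_le P hP
  · intro v hv
    have hv' : v ∈ A ∪ Z ∨ v ∈ B ∪ Z := by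
      rw [hW] at hv
      simp only [Finset.mem_union] at hv ⊢
      tauto
    rcases hv' with hv | hv
    · obtain ⟨P, hP, hvP⟩ := hD.cover v hv
      exact ⟨P, Finset.mem_union_left _ hP, hvP⟩
    · obtain ⟨P, hP, hvP⟩ := hE.cover v hv
      exact ⟨P, Finset.mem_union_right _ hP, hvP⟩
  · intro u hu v hv huv
    have huv' : (u ∈ A ∪ Z ∧ v ∈ A ∪ Z) ∨ (u ∈ B ∪ Z ∧ v ∈ B ∪ Z) := by
      have h1 := hadj u
      have h2 := hadj v
      have h3 := hs _ _ huv
      rw [hW] at hu hv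
      simp only [Finset.mem_union] at hu hv ⊢
      grind
    rcases huv' with ⟨hu, hv⟩ | ⟨hu, hv⟩
    · obtain ⟨P, hP, hvP⟩ := hD.edge u hu v hv huv
      exact ⟨P, Finset.mem_union_left _ hP, hvP⟩
    · obtain ⟨P, hP, hvP⟩ := hE.edge u hu v hv huv
      exact ⟨P, Finset.mem_union_right _ hP, hvP⟩
  have hsum : ∑ P ∈ D ∪ E, P.card ≤ ∑ P ∈ D, P.card + ∑ P ∈ E, P.card := by
    rw [← Finset.sum_union_inter]
    exact Nat.le_add_right _ _
  have hsum' : ((∑ P ∈ D ∪ E, P.card : ℕ) : ℝ) ≤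
      (∑ P ∈ D, P.card : ℕ) + (∑ P ∈ E, P.card : ℕ) := by exact_mod_cast hsum
  have ha2 : √((A.card + Z.card : ℕ) : ℝ) ^ 2 = (A.card + Z.card : ℕ) :=
    Real.sq_sqrt (by positivity)
  have hb2 : √((B.card + Z.card : ℕ) : ℝ) ^ 2 = (B.card + Z.card : ℕ) :=
    Real.sq_sqrt (by positivity)
  have hsqrt : 4 / 3 * √(n : ℝ) ≤
      √((A.card + Z.card : ℕ) : ℝ) + √((B.card + Z.card : ℕ) : ℝ) := by
    refine four_thirds_mul_le (Real.sqrt_nonneg _) (Real.sqrt_nonneg _) ?_ ?_ ?_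
    · rw [hs2, ha2]; exact_mod_cast (by omega : n ≤ 4 * (A.card + Z.card))
    · rw [hs2, hb2]; exact_mod_cast (by omega : n ≤ 4 * (B.card + Z.card))
    · rw [hs2, ha2, hb2]
      exact_mod_cast (by omega : n ≤ (A.card + Z.card) + (B.card + Z.card))
  have hq : 204 / √(r : ℝ) ≤ 1 := (div_le_one hρ).2 hr
  have hq0 : 0 ≤ 204 / √(r : ℝ) := by positivity
  have hzq : (Z.card : ℝ) * (204 / √(r : ℝ)) ≤ Z.card :=
    mul_le_of_le_one_right (by positivity) hq
  have hcW' : (n : ℝ) = A.card + B.card + Z.card := by exact_mod_cast hcW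
  push_cast at hDs hEs hsqrt hsum' ⊢
  generalize 204 / √(r : ℝ) = q at *
  rw [hcW'] at hs2 hsqrt hZ ⊢
  nlinarith

theorem exists_isDivision (hs : ∀ u v, adj u v → adj v u) (hK5 : NoK5 adj) {r : ℕ}
    (hr : (204 : ℝ) ≤ √(r : ℝ)) (W : Finset V) :
    ∃ D, IsDivision adj W r D ∧
      ((∑ P ∈ D, P.card : ℕ) : ℝ) ≤ W.card * (1 + 204 / √(r : ℝ)) := by
  rcases le_or_gt r (4 * W.card) with h | h
  · obtain ⟨D, hD, hsum⟩ := exists_isDivision_aux hs hK5 hr _ W rfl h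
    have := Real.sqrt_nonneg (W.card : ℝ)
    exact ⟨D, hD, by linarith⟩
  · refine ⟨{W}, isDivision_singleton (by omega), ?_⟩
    rw [Finset.sum_singleton]
    exact le_mul_of_one_le_right (by positivity) (le_add_of_nonneg_right (by positivity))

/-- The local search bound: if `Q` cannot be improved by exchanges confined to small sets `P`
which contain all neighbours of the exchanged vertices, then `Q` is almost as small as `O`. -/
theorem card_le_of_locally_optimal (hs : ∀ u v, adj u v → adj v u) (hK5 : NoK5 adj) {b : ℕ}
    (hb : (204 : ℝ) ≤ √(b : ℝ)) (Q O : Finset V)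
    (hopt : ∀ P X, P ⊆ Q ∪ O → P.card ≤ b → X ⊆ Q → X ⊆ P →
      (∀ u ∈ X, ∀ w ∈ O, adj u w → w ∈ P) → X.card ≤ (O ∩ P).card) :
    (Q.card : ℝ) ≤ O.card + 2 * (204 / √(b : ℝ)) * (Q.card + O.card) := by
  obtain ⟨D, hD, hsum⟩ := exists_isDivision hs hK5 hb (Q ∪ O)
  let m : V → ℕ := fun v => (D.filter fun P => v ∈ P).card
  have hm : ∀ v ∈ Q ∪ O, 1 ≤ m v := fun v hv => by
    obtain ⟨P, hP, hvP⟩ := hD.cover v hv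
    exact Finset.card_pos.2 ⟨P, Finset.mem_filter.2 ⟨hP, hvP⟩⟩
  have hdouble : ∀ S : Finset V, ∑ P ∈ D, (S ∩ P).card = ∑ v ∈ S, m v := fun S => by
    simp only [m, Finset.card_filter]
    rw [Finset.sum_comm]
    refine Finset.sum_congr rfl fun P _ => ?_
    rw [← Finset.card_filter, Finset.filter_mem_eq_inter]
  have hloc : ∀ P ∈ D, ((Q.filter fun v => m v = 1) ∩ P).card ≤ (O ∩ P).card := fun P hP => by
    refine hopt P _ (hD.subset P hP) (hD.card_le P hP)
      (Finset.inter_subset_left.trans (Finset.filter_subset _ _)) Finset.inter_subset_right ?_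
    intro u hu w hw huw
    rw [Finset.mem_inter, Finset.mem_filter] at hu
    obtain ⟨P', hP', huP', hwP'⟩ := hD.edge u (Finset.mem_union_left _ hu.1.1) w
      (Finset.mem_union_right _ hw) huw
    obtain ⟨P₀, hP₀⟩ := Finset.card_eq_one.1 hu.1.2
    have h1 : P ∈ ({P₀} : Finset (Finset V)) := hP₀ ▸ Finset.mem_filter.2 ⟨hP, hu.2⟩
    have h2 : P' ∈ ({P₀} : Finset (Finset V)) := hP₀ ▸ Finset.mem_filter.2 ⟨hP', huP'⟩
    rw [Finset.mem_singleton] at h1 h2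
    rwa [h1, ← h2]
  have h1 : ∑ v ∈ Q.filter (fun v => m v = 1), m v ≤ ∑ v ∈ O, m v := by
    rw [← hdouble, ← hdouble]
    exact Finset.sum_le_sum hloc
  have h2 : 2 * Q.card ≤ ∑ v ∈ Q.filter (fun v => m v = 1), m v + ∑ v ∈ Q, m v := by
    rw [Finset.sum_filter, ← Finset.sum_add_distrib, mul_comm, ← smul_eq_mul, ← Finset.sum_const]
    refine Finset.sum_le_sum fun v hv => ?_
    have := hm v (Finset.mem_union_left _ hv)
    split_ifs <;> omega
  have h3 : ∑ P ∈ D, P.card = ∑ v ∈ Q ∪ O, m v := by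
    rw [← hdouble]
    exact Finset.sum_congr rfl fun P hP => by rw [Finset.inter_eq_right.2 (hD.subset P hP)]
  have hexc : ∀ S ⊆ Q ∪ O, ∑ v ∈ S, m v + (Q ∪ O).card ≤ ∑ v ∈ Q ∪ O, m v + S.card := by
    intro S hS
    have h4 := Finset.sum_sdiff (f := m) hS
    have h5 := Finset.card_sdiff_add_card_eq_card hS
    have h6 : ((Q ∪ O) \ S).card ≤ ∑ v ∈ (Q ∪ O) \ S, m v := by
      rw [Finset.card_eq_sum_ones]
      exact Finset.sum_le_sum fun v hv => hm v (Finset.sdiff_subset hv)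
    omega
  have hQ := hexc Q Finset.subset_union_left
  have hO := hexc O Finset.subset_union_right
  have h7 : Q.card + 2 * (Q ∪ O).card ≤ O.card + 2 * ∑ P ∈ D, P.card := by omega
  have h8 : (Q.card : ℝ) + 2 * (Q ∪ O).card ≤ O.card + 2 * (∑ P ∈ D, P.card : ℕ) := by
    exact_mod_cast h7
  have h9 : ((Q ∪ O).card : ℝ) ≤ Q.card + O.card := by
    exact_mod_cast Finset.card_union_le Q O
  have hq0 : 0 ≤ 204 / √(b : ℝ) := by positivity
  nlinarith [mul_le_mul_of_nonneg_right h9 hq0]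

end GraphSeparation

namespace PlaneTopology

theorem exists_continuous_exp_eq {X : Type*} [TopologicalSpace X] [SimplyConnectedSpace X]
    [LocallyPathConnectedSpace X] {f : X → ℂ} (hf : Continuous f) (h0 : ∀ x, f x ≠ 0) :
    ∃ L : X → ℂ, Continuous L ∧ ∀ x, Complex.exp (L x) = f x := by
  obtain ⟨x₀⟩ : Nonempty X := inferInstance
  obtain ⟨L, ⟨-, hL⟩, -⟩ := Complex.isCoveringMap_exp.existsUnique_continuousMap_lifts
    (⟨fun x => ⟨f x, h0 x⟩, by fun_prop⟩ : C(X, {z : ℂ // z ≠ 0})) (a₀ := x₀)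
    (e₀ := Complex.log (f x₀)) (Subtype.ext (Complex.exp_log (h0 x₀)))
  exact ⟨L, L.continuous, fun x => congrArg Subtype.val (congrFun hL x)⟩

theorem sub_eq_sub_of_exp_eq_mul {f g : ℝ → ℂ} (hf : Continuous f) (hg : Continuous g) {k : ℂ}
    (h : ∀ s, Complex.exp (f s) = k * Complex.exp (g s)) (x y : ℝ) :
    f x - f y = g x - g y := by
  have hc : (fun s => f s - g s) = fun _ => f y - g y := by
    refine Complex.isCoveringMap_exp.eq_of_comp_eq (hf.sub hg) continuous_const ?_ y rfl
    funext s
    refine Subtype.ext ?_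
    simp only [Function.comp_apply, Complex.exp_sub, h]
    rw [mul_div_assoc, mul_div_assoc, div_self (Complex.exp_ne_zero _),
      div_self (Complex.exp_ne_zero _)]
  have := congrFun hc x
  linear_combination this

/-- The complete graph on five vertices cannot be drawn in the plane in such a way that the edges
without common endpoint do not meet. -/
theorem not_pathConnected_union_of_disjoint (U : Fin 5 → Set ℂ) (hU : ∀ i, (U i).Nonempty)
    (hd : ∀ i j, i ≠ j → Disjoint (U i) (U j)) :
    ¬ ∀ i j, i ≠ j → IsPathConnected (U i ∪ U j) := by
  intro hpc
  choose p hp using hU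
  have hpath : ∀ i j, ∃ γ : ℝ → ℂ, i ≠ j → Continuous γ ∧ γ 0 = p i ∧ γ 1 = p j ∧
      ∀ s, γ s ∈ U i ∪ U j := by
    intro i j
    by_cases hij : i = j
    · exact ⟨0, fun h => (h hij).elim⟩
    obtain ⟨γ, hγ⟩ := (hpc i j hij).joinedIn (p i) (Or.inl (hp i)) (p j) (Or.inr (hp j))
    refine ⟨γ.extend, fun _ => ⟨γ.continuous_extend, γ.extend_zero, γ.extend_one, fun s => ?_⟩⟩
    obtain ⟨t, ht⟩ : γ.extend s ∈ range γ := by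
      rw [← γ.extend_range]; exact mem_range_self s
    rw [← ht]
    exact hγ t
  choose γ hγ using hpath
  have hne : ∀ {i j : Fin 5} {x y : ℂ} , i ≠ j → x ∈ U i → y ∈ U j → y - x ≠ 0 := by
    intro i j x y hij hx hy h
    rw [sub_eq_zero] at h
    exact Set.disjoint_left.1 (hd i j hij) hx (h ▸ hy)
  have hlift : ∀ v a b, ∃ M : ℝ → ℂ, v ≠ a → v ≠ b → a ≠ b →
      Continuous M ∧ ∀ s, Complex.exp (M s) = γ a b s - p v := by
    intro v a b
    by_cases h : v ≠ a ∧ v ≠ b ∧ a ≠ b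
    · obtain ⟨hva, hvb, hab⟩ := h
      obtain ⟨hc, -, -, hmem⟩ := hγ a b hab
      obtain ⟨M, hM, hM'⟩ := exists_continuous_exp_eq (f := fun s => γ a b s - p v)
        (hc.sub continuous_const) (fun s => by
          rcases hmem s with h | h
          · exact hne hva (hp v) h
          · exact hne hvb (hp v) h)
      exact ⟨M, fun _ _ _ => ⟨hM, hM'⟩⟩
    · exact ⟨0, fun h1 h2 h3 => (h ⟨h1, h2, h3⟩).elim⟩
  choose M hM using hlift
  have hrel : ∀ a b c d, a ≠ b → c ≠ d → a ≠ c → a ≠ d → b ≠ c → b ≠ d →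
      (M c a b 1 - M c a b 0) + (M b c d 1 - M b c d 0) =
      (M d a b 1 - M d a b 0) + (M a c d 1 - M a c d 0) := by
    intro a b c d hab hcd hac had hbc hbd
    obtain ⟨h1, h1a, h1b, h1m⟩ := hγ a b hab
    obtain ⟨h2, h2c, h2d, h2m⟩ := hγ c d hcd
    obtain ⟨L, hL, hL'⟩ := exists_continuous_exp_eq
      (f := fun x : ℝ × ℝ => γ c d x.2 - γ a b x.1) (by fun_prop) (fun x => by
        rcases h1m x.1 with h | h <;> rcases h2m x.2 with h' | h'
        · exact hne hac h h'
        · exact hne had h h'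
        · exact hne hbc h h'
        · exact hne hbd h h')
    obtain ⟨m1, m1'⟩ := hM c a b hac.symm hbc.symm hab
    obtain ⟨m2, m2'⟩ := hM b c d hbc hbd hcd
    obtain ⟨m3, m3'⟩ := hM d a b had.symm hbd.symm hab
    obtain ⟨m4, m4'⟩ := hM a c d hac had hcd
    have e1 := sub_eq_sub_of_exp_eq_mul (f := fun s => L (s, 0)) (k := -1) (by fun_prop) m1
      (fun s => by rw [hL', m1', h2c]; ring) 1 0
    have e2 := sub_eq_sub_of_exp_eq_mul (f := fun s => L (1, s)) (k := 1) (by fun_prop) m2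
      (fun s => by rw [hL', m2', h1b]; ring) 1 0
    have e3 := sub_eq_sub_of_exp_eq_mul (f := fun s => L (s, 1)) (k := -1) (by fun_prop) m3
      (fun s => by rw [hL', m3', h2d]; ring) 1 0
    have e4 := sub_eq_sub_of_exp_eq_mul (f := fun s => L (0, s)) (k := 1) (by fun_prop) m4
      (fun s => by rw [hL', m4', h1a]; ring) 1 0
    linear_combination -e1 - e2 + e3 + e4
  have hθ : ∃ θ : Fin 5 → Fin 5 → ℂ, (∀ x y, x ≠ y → Complex.exp (θ x y) = p y - p x) ∧
      ∀ x y, x < y → θ y x = θ x y + Real.pi * Complex.I := by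
    refine ⟨fun x y => if x < y then Complex.log (p y - p x) else
      Complex.log (p x - p y) + Real.pi * Complex.I, fun x y hxy => ?_, fun x y hxy => ?_⟩
    · rcases lt_or_gt_of_ne hxy with h | h
      · simp only [h, if_true]
        exact Complex.exp_log (hne hxy (hp x) (hp y))
      · simp only [h.not_gt, if_false]
        rw [Complex.exp_add, Complex.exp_pi_mul_I, Complex.exp_log (hne hxy.symm (hp y) (hp x))]
        ring
    · simp only [hxy, hxy.not_gt, if_true, if_false]
  obtain ⟨θ, hθ, hθ'⟩ := hθ
  have hn : ∀ v a b, ∃ n : ℤ, v ≠ a → v ≠ b → a ≠ b →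
      M v a b 1 - M v a b 0 = θ v b - θ v a + n * (2 * Real.pi * Complex.I) := by
    intro v a b
    by_cases h : v ≠ a ∧ v ≠ b ∧ a ≠ b
    · obtain ⟨hva, hvb, hab⟩ := h
      obtain ⟨-, h1a, h1b, -⟩ := hγ a b hab
      obtain ⟨-, hM'⟩ := hM v a b hva hvb hab
      obtain ⟨n, hn⟩ := Complex.exp_eq_exp_iff_exists_int.1
        (show Complex.exp (M v a b 1 - M v a b 0) = Complex.exp (θ v b - θ v a) by
          rw [Complex.exp_sub, Complex.exp_sub, hM', hM', h1a, h1b, hθ v b hvb, hθ v a hva])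
      exact ⟨n, fun _ _ _ => hn⟩
    · exact ⟨0, fun h1 h2 h3 => (h ⟨h1, h2, h3⟩).elim⟩
  choose n hn using hn
  have hε : ∀ x y, x ≠ y → θ x y - θ y x = ((if x < y then -1 else 1 : ℤ) : ℂ) *
      (Real.pi * Complex.I) := by
    intro x y hxy
    rcases lt_or_gt_of_ne hxy with h | h
    · rw [if_pos h, hθ' x y h]; push_cast; ring
    · rw [if_neg h.not_gt, hθ' y x h]; push_cast; ring
  have hparity : ∀ a b c d, a ≠ b → c ≠ d → a ≠ c → a ≠ d → b ≠ c → b ≠ d →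
      2 * (n c a b + n b c d - n d a b - n a c d) =
        -((if c < b then -1 else 1) + (if a < c then -1 else 1) + (if b < d then -1 else 1) +
          (if d < a then -1 else 1)) := by
    intro a b c d hab hcd hac had hbc hbd
    have h := hrel a b c d hab hcd hac had hbc hbd
    rw [hn c a b hac.symm hbc.symm hab, hn b c d hbc hbd hcd, hn d a b had.symm hbd.symm hab,
      hn a c d hac had hcd] at h
    have hpi : (Real.pi : ℂ) * Complex.I ≠ 0 :=
      mul_ne_zero (by exact_mod_cast Real.pi_ne_zero) Complex.I_ne_zero
    have e1 := hε c b hbc.symm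
    have e2 := hε a c hac
    have e3 := hε b d hbd
    have e4 := hε d a had.symm
    have : ((2 * (n c a b + n b c d - n d a b - n a c d) : ℤ) : ℂ) =
        ((-((if c < b then -1 else 1) + (if a < c then -1 else 1) + (if b < d then -1 else 1) +
          (if d < a then -1 else 1)) : ℤ) : ℂ) := by
      apply mul_right_cancel₀ hpi
      rw [Int.cast_neg, Int.cast_add, Int.cast_add, Int.cast_add, neg_mul, add_mul, add_mul, add_mul,
        ← e1, ← e2, ← e3, ← e4]
      push_cast
      linear_combination h
    exact_mod_cast this
  have i1 := hparity 0 1 2 3 (by simp) (by simp) (by simp) (by simp) (by simp) (by simp)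
  have i2 := hparity 0 1 2 4 (by simp) (by simp) (by simp) (by simp) (by simp) (by simp)
  have i3 := hparity 0 1 3 4 (by simp) (by simp) (by simp) (by simp) (by simp) (by simp)
  have i4 := hparity 0 2 1 3 (by simp) (by simp) (by simp) (by simp) (by simp) (by simp)
  have i5 := hparity 0 2 1 4 (by simp) (by simp) (by simp) (by simp) (by simp) (by simp)
  have i6 := hparity 0 2 3 4 (by simp) (by simp) (by simp) (by simp) (by simp) (by simp)
  have i7 := hparity 0 3 1 2 (by simp) (by simp) (by simp) (by simp) (by simp) (by simp)
  have i8 := hparity 0 3 1 4 (by simp) (by simp) (by simp) (by simp) (by simp) (by simp)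
  have i9 := hparity 0 3 2 4 (by simp) (by simp) (by simp) (by simp) (by simp) (by simp)
  have i10 := hparity 0 4 1 2 (by simp) (by simp) (by simp) (by simp) (by simp) (by simp)
  have i11 := hparity 0 4 1 3 (by simp) (by simp) (by simp) (by simp) (by simp) (by simp)
  have i12 := hparity 0 4 2 3 (by simp) (by simp) (by simp) (by simp) (by simp) (by simp)
  have i13 := hparity 1 2 3 4 (by simp) (by simp) (by simp) (by simp) (by simp) (by simp)
  have i14 := hparity 1 3 2 4 (by simp) (by simp) (by simp) (by simp) (by simp) (by simp)
  have i15 := hparity 1 4 2 3 (by simp) (by simp) (by simp) (by simp) (by simp) (by simp)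
  simp [Fin.lt_def] at i1 i2 i3 i4 i5 i6 i7 i8 i9 i10 i11 i12 i13 i14 i15
  omega

/-- The plane, identified with the complex numbers. -/
def toComplex (x : Plane) : ℂ := x 0 + x 1 * Complex.I

theorem continuous_toComplex : Continuous toComplex := by
  unfold toComplex
  fun_prop

theorem toComplex_injective : Function.Injective toComplex := by
  intro x y h
  have h0 := congrArg Complex.re h
  have h1 := congrArg Complex.im h
  simp [toComplex] at h0 h1
  ext i
  fin_cases i
  · exact h0
  · exact h1

open GraphSeparation

/-- Two cells are adjacent if their union is path connected. -/
def CellAdj {V : Type*} (A : V → Set Plane) (u v : V) : Prop :=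
  u ≠ v ∧ IsPathConnected (A u ∪ A v)

theorem CellAdj.symm {V : Type*} {A : V → Set Plane} (u v : V) (h : CellAdj A u v) :
    CellAdj A v u :=
  ⟨h.1.symm, union_comm (A u) (A v) ▸ h.2⟩

theorem isPathConnected_biUnion_of_connSet {V : Type*} {A : V → Set Plane}
    (hA : ∀ v, IsPathConnected (A v)) {B : Finset V} (hB : ConnSet (CellAdj A) B) :
    IsPathConnected (⋃ v ∈ B, A v) := by
  obtain ⟨⟨u, hu⟩, h⟩ := hB
  obtain ⟨x, hx⟩ := (hA u).nonempty
  have hsub : ∀ {v}, v ∈ B → A v ⊆ ⋃ v ∈ B, A v := fun hv => subset_biUnion_of_mem (u := A) hv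
  refine ⟨x, hsub hu hx, fun {y} hy => ?_⟩
  obtain ⟨v, hv, hy⟩ := mem_iUnion₂.1 hy
  have hr := h u hu v hv
  unfold Reach at hr
  clear hv
  induction hr generalizing y with
  | refl => exact ((hA u).joinedIn x hx y hy).mono (hsub hu)
  | @tail b c _ hbc ih =>
    obtain ⟨z, hz⟩ := (hA b).nonempty
    exact (ih (hsub hbc.2.1 hz) hz).trans
      ((hbc.1.2.joinedIn z (Or.inl hz) y (Or.inr hy)).mono
        (union_subset (hsub hbc.2.1) (hsub hbc.2.2)))

theorem noK5_cellAdj {V : Type*} {A : V → Set Plane} (hA : ∀ v, IsPathConnected (A v))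
    (hd : ∀ u v, u ≠ v → Disjoint (A u) (A v)) : NoK5 (CellAdj A) := by
  rintro ⟨B, hB, hBd, hadj⟩
  have hpc := fun i => isPathConnected_biUnion_of_connSet hA (hB i)
  refine not_pathConnected_union_of_disjoint (fun i => toComplex '' ⋃ v ∈ B i, A v)
    (fun i => (hpc i).nonempty.image _) (fun i j hij => ?_) (fun i j hij => ?_)
  · refine (Set.disjoint_image_iff toComplex_injective).2 ?_
    simp only [disjoint_iUnion_left, disjoint_iUnion_right]
    intro v hv u hu
    refine hd _ _ ?_
    rintro rfl
    exact Finset.disjoint_left.1 (hBd i j hij) (by assumption) (by assumption)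
  · rw [← image_union]
    refine IsPathConnected.image ?_ continuous_toComplex
    obtain ⟨u, hu, v, hv, huv⟩ := hadj i j hij
    have h1 : IsPathConnected ((⋃ v ∈ B i, A v) ∪ (A u ∪ A v)) :=
      (hpc i).union huv.2 ((hA u).nonempty.mono
        (subset_inter (subset_biUnion_of_mem (u := A) hu) subset_union_left))
    have h2 : IsPathConnected (((⋃ v ∈ B i, A v) ∪ (A u ∪ A v)) ∪ ⋃ v ∈ B j, A v) :=
      h1.union (hpc j) ((hA v).nonempty.mono
        (subset_inter (subset_union_right.trans subset_union_right)
          (subset_biUnion_of_mem (u := A) hv)))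
    convert h2 using 1
    have e1 := subset_biUnion_of_mem (u := A) hu
    have e2 := subset_biUnion_of_mem (u := A) hv
    ext z
    have e1 := @e1 z
    have e2 := @e2 z
    simp only [mem_union] at *
    tauto

end PlaneTopology

namespace GaugeCells

/-- `g` is the gauge of a convex body containing the origin in its interior. -/
structure IsGauge (g : Plane → ℝ) : Prop where
  nonneg : ∀ x, 0 ≤ g x
  add_le : ∀ x y, g (x + y) ≤ g x + g y
  smul : ∀ (t : ℝ) x, 0 ≤ t → g (t • x) = t * g x
  eq_zero : ∀ x, g x = 0 → x = 0
  continuous : Continuous g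
  compact : ∀ t, IsCompact {z | g z ≤ t}

/-- The ball with centre `b.1` and radius `b.2`. -/
def gball (g : Plane → ℝ) (b : Plane × ℝ) : Set Plane := {z | g (z - b.1) ≤ b.2}

/-- The distance from a point to a ball. -/
noncomputable def gdist (g : Plane → ℝ) (b : Plane × ℝ) (x : Plane) : ℝ :=
  sInf ((fun q => g (q - x)) '' gball g b)

/-- The signed distance from a point to a ball. -/
noncomputable def height (g : Plane → ℝ) (b : Plane × ℝ) (x : Plane) : ℝ :=
  min (g (x - b.1) - b.2) 0 + gdist g b x

/-- A certificate that every ball of height at most `c` at `z` meets `gball g S`. -/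
def Reaches (g : Plane → ℝ) (S : Plane × ℝ) (z : Plane) (c : ℝ) : Prop :=
  g (z - S.1) + max c 0 ≤ S.2 ∨ ∃ a ∈ gball g S, c + g (a - z) ≤ 0

/-- Passing from `z` to `z'` preserves the comparisons of the height of `b` with other heights, as
well as the certificates provided by the height of `b`. -/
def Toward (g : Plane → ℝ) (b : Plane × ℝ) (z z' : Plane) : Prop :=
  (∀ b' : Plane × ℝ, 0 < b'.2 → (height g b z ≤ height g b' z → height g b z' ≤ height g b' z') ∧
    (height g b z < height g b' z → height g b z' < height g b' z')) ∧
  ∀ S, Reaches g S z (height g b z) → Reaches g S z' (height g b z')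

variable {g : Plane → ℝ} {b : Plane × ℝ}

theorem Toward.refl (z : Plane) : Toward g b z z :=
  ⟨fun _ _ => ⟨id, id⟩, fun _ => id⟩

theorem Toward.trans {x y z : Plane} (h : Toward g b x y) (h' : Toward g b y z) :
    Toward g b x z :=
  ⟨fun b' hb' => ⟨fun h1 => (h'.1 b' hb').1 ((h.1 b' hb').1 h1),
    fun h1 => (h'.1 b' hb').2 ((h.1 b' hb').2 h1)⟩, fun S h1 => h'.2 S (h.2 S h1)⟩

namespace IsGauge

theorem map_zero (hg : IsGauge g) : g 0 = 0 := by
  simpa using hg.smul 0 0 le_rfl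

theorem sub_le (hg : IsGauge g) (x y z : Plane) : g (x - z) ≤ g (x - y) + g (y - z) := by
  simpa using hg.add_le (x - y) (y - z)

theorem isCompact_gball (hg : IsGauge g) (b : Plane × ℝ) : IsCompact (gball g b) := by
  convert (hg.compact b.2).image (continuous_add_const b.1) using 1
  ext z
  simp [gball, sub_eq_add_neg]

theorem center_mem (hg : IsGauge g) (hb : 0 < b.2) : b.1 ∈ gball g b := by
  simp [gball, hg.map_zero, hb.le]

theorem exists_gdist_eq (hg : IsGauge g) (hb : 0 < b.2) (x : Plane) :
    ∃ q ∈ gball g b, gdist g b x = g (q - x) :=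
  (hg.isCompact_gball b).exists_sInf_image_eq ⟨_, hg.center_mem hb⟩
    (hg.continuous.comp (continuous_sub_right x)).continuousOn

theorem gdist_le (hg : IsGauge g) {x q : Plane} (hq : q ∈ gball g b) :
    gdist g b x ≤ g (q - x) :=
  csInf_le ⟨0, by rintro _ ⟨z, -, rfl⟩; exact hg.nonneg _⟩ ⟨q, hq, rfl⟩

theorem gdist_le_add (hg : IsGauge g) (hb : 0 < b.2) (x y : Plane) :
    gdist g b x ≤ gdist g b y + g (y - x) := by
  obtain ⟨q, hq, h⟩ := hg.exists_gdist_eq hb y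
  rw [h]
  exact (hg.gdist_le hq).trans (hg.sub_le _ _ _)

theorem gdist_nonneg (hg : IsGauge g) (hb : 0 < b.2) (x : Plane) : 0 ≤ gdist g b x := by
  obtain ⟨q, hq, h⟩ := hg.exists_gdist_eq hb x
  rw [h]
  exact hg.nonneg _

theorem height_of_mem (hg : IsGauge g) (hb : 0 < b.2) {x : Plane} (hx : x ∈ gball g b) :
    height g b x = g (x - b.1) - b.2 := by
  have h1 : gdist g b x ≤ 0 := by simpa [hg.map_zero] using hg.gdist_le (x := x) hx
  have h2 : g (x - b.1) - b.2 ≤ 0 := sub_nonpos.2 hx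
  rw [height, min_eq_left h2, le_antisymm h1 (hg.gdist_nonneg hb x), add_zero]

theorem height_of_notMem {x : Plane} (hx : x ∉ gball g b) :
    height g b x = gdist g b x := by
  have h2 : 0 ≤ g (x - b.1) - b.2 := sub_nonneg.2 (not_le.1 hx).le
  rw [height, min_eq_right h2, zero_add]

theorem gdist_pos (hg : IsGauge g) (hb : 0 < b.2) {x : Plane} (hx : x ∉ gball g b) :
    0 < gdist g b x := by
  refine (hg.gdist_nonneg hb x).lt_of_ne fun h => hx ?_
  obtain ⟨q, hq, h'⟩ := hg.exists_gdist_eq hb x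
  rwa [sub_eq_zero.1 (hg.eq_zero _ (h'.symm.trans h.symm))] at hq

theorem notMem_of_height_pos (hg : IsGauge g) (hb : 0 < b.2) {x : Plane}
    (hx : 0 < height g b x) : x ∉ gball g b := fun h => by
  rw [hg.height_of_mem hb h] at hx
  exact absurd (show g (x - b.1) ≤ b.2 from h) (by linarith)

theorem height_le_gdist (x : Plane) : height g b x ≤ gdist g b x := by
  have := min_le_right (g (x - b.1) - b.2) 0
  rw [height]
  linarith

theorem continuous_gdist (hg : IsGauge g) (hb : 0 < b.2) : Continuous (gdist g b) := by
  have hc := hg.continuous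
  refine continuous_iff_continuousAt.2 fun x => ?_
  have h1 : Continuous fun z => gdist g b x - g (z - x) := by fun_prop
  have h2 : Continuous fun z => gdist g b x + g (x - z) := by fun_prop
  refine tendsto_of_tendsto_of_tendsto_of_le_of_le (by simpa [hg.map_zero] using h1.tendsto x)
    (by simpa [hg.map_zero] using h2.tendsto x) (fun z => ?_) (fun z => ?_)
  · have := hg.gdist_le_add hb x z
    simp only
    linarith
  · exact hg.gdist_le_add hb z x

theorem continuous_height (hg : IsGauge g) (hb : 0 < b.2) : Continuous (height g b) := by
  have h1 := hg.continuous
  have h2 := hg.continuous_gdist hb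
  unfold height
  fun_prop

theorem inter_nonempty_of_reaches (hg : IsGauge g) (hb : 0 < b.2) {S : Plane × ℝ} {z : Plane}
    {c : ℝ} (h : Reaches g S z c) (hc : height g b z ≤ c) : (gball g S ∩ gball g b).Nonempty := by
  by_cases hz : z ∈ gball g b
  · rcases h with h | ⟨a, ha, h⟩
    · exact ⟨z, le_trans (by linarith [le_max_right c 0]) h, hz⟩
    · refine ⟨a, ha, ?_⟩
      rw [hg.height_of_mem hb hz] at hc
      have := hg.sub_le a z b.1
      simp only [gball, mem_ofPred_eq]
      linarith
  · have h0 := hg.gdist_pos hb hz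
    rw [height_of_notMem hz] at hc
    rcases h with h | ⟨a, ha, h⟩
    · obtain ⟨q, hq, hq'⟩ := hg.exists_gdist_eq hb z
      refine ⟨q, ?_, hq⟩
      have := hg.sub_le q z S.1
      have := le_max_left c 0
      simp only [gball, mem_ofPred_eq]
      linarith
    · linarith [hg.nonneg (a - z)]

theorem reaches_of_inter_nonempty (hg : IsGauge g) {S : Plane × ℝ} (hS : 0 < S.2)
    (h : (gball g S ∩ gball g b).Nonempty) : Reaches g S S.1 (height g b S.1) := by
  obtain ⟨q, hq, hqb⟩ := h
  left
  rw [sub_self, hg.map_zero, zero_add]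
  exact max_le ((height_le_gdist _).trans ((hg.gdist_le hqb).trans hq)) hS.le

theorem toward_nearest (hg : IsGauge g) (hb : 0 < b.2) {z q : Plane} (hz : z ∉ gball g b)
    (hq : q ∈ gball g b) (hzq : gdist g b z = g (q - z)) {s : ℝ} (hs : s ∈ Icc (0 : ℝ) 1) :
    Toward g b z (z + s • (q - z)) := by
  have hpos := hg.gdist_pos hb hz
  have hnear : ∀ s ∈ Icc (0 : ℝ) 1, gdist g b (z + s • (q - z)) ≤ (1 - s) * gdist g b z := by
    intro s hs
    have h1 := hg.gdist_le (x := z + s • (q - z)) hq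
    rwa [show q - (z + s • (q - z)) = (1 - s) • (q - z) by module,
      hg.smul _ _ (sub_nonneg.2 hs.2), ← hzq] at h1
  have hstep : ∀ s ∈ Icc (0 : ℝ) 1, g (z + s • (q - z) - z) = s * gdist g b z := by
    intro s hs
    rw [add_sub_cancel_left, hg.smul _ _ hs.1, hzq]
  refine ⟨fun b' hb' => ⟨fun h => ?_, fun h => ?_⟩, fun S hS => ?_⟩
  · rw [height_of_notMem hz] at h
    have hz' := hg.notMem_of_height_pos hb' (hpos.trans_le h)
    rw [height_of_notMem hz'] at h
    have hcl : IsClosed {s : ℝ | height g b (z + s • (q - z)) ≤ height g b' (z + s • (q - z))} := by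
      have h1 := hg.continuous_height hb
      have h2 := hg.continuous_height hb'
      exact isClosed_le (by fun_prop) (by fun_prop)
    have hsub : Ico (0 : ℝ) 1 ⊆
        {s : ℝ | height g b (z + s • (q - z)) ≤ height g b' (z + s • (q - z))} := by
      intro s hs
      have hs' : s ∈ Icc (0 : ℝ) 1 := ⟨hs.1, hs.2.le⟩
      have h1 := hg.gdist_le_add hb' z (z + s • (q - z))
      rw [hstep s hs'] at h1
      have h2 := hnear s hs'
      have h3 : 0 < (1 - s) * gdist g b z := mul_pos (sub_pos.2 hs.2) hpos
      have h4 : z + s • (q - z) ∉ gball g b' := fun hm => by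
        have := hg.gdist_le (x := z + s • (q - z)) hm
        rw [sub_self, hg.map_zero] at this
        linarith
      rw [mem_ofPred_eq, height_of_notMem h4]
      exact (height_le_gdist _).trans (by linarith)
    have := hcl.closure_subset_iff.2 hsub
    rw [closure_Ico zero_ne_one] at this
    exact this hs
  · rw [height_of_notMem hz] at h
    have hz' := hg.notMem_of_height_pos hb' (hpos.trans h)
    rw [height_of_notMem hz'] at h
    have h1 := hg.gdist_le_add hb' z (z + s • (q - z))
    rw [hstep s hs] at h1
    have h2 := hnear s hs
    have h3 : 0 ≤ (1 - s) * gdist g b z := mul_nonneg (sub_nonneg.2 hs.2) hpos.le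
    have h4 : z + s • (q - z) ∉ gball g b' := fun hm => by
      have := hg.gdist_le (x := z + s • (q - z)) hm
      rw [sub_self, hg.map_zero] at this
      linarith
    rw [height_of_notMem h4]
    exact (height_le_gdist _).trans_lt (by linarith)
  · rw [height_of_notMem hz] at hS
    rcases hS with hS | ⟨a, -, ha⟩
    · left
      rw [max_eq_left hpos.le] at hS
      have h1 := hg.sub_le (z + s • (q - z)) z S.1
      rw [hstep s hs] at h1
      have h2 : max (height g b (z + s • (q - z))) 0 ≤ (1 - s) * gdist g b z :=
        max_le ((height_le_gdist _).trans (hnear s hs))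
          (mul_nonneg (sub_nonneg.2 hs.2) hpos.le)
      linarith
    · linarith [hg.nonneg (a - z)]

theorem toward_center (hg : IsGauge g) (hb : 0 < b.2) {z : Plane} (hz : z ∈ gball g b) {s : ℝ}
    (hs : s ∈ Icc (0 : ℝ) 1) : Toward g b z (z + s • (b.1 - z)) := by
  have h1 : g (z + s • (b.1 - z) - b.1) = (1 - s) * g (z - b.1) := by
    rw [show z + s • (b.1 - z) - b.1 = (1 - s) • (z - b.1) by module,
      hg.smul _ _ (sub_nonneg.2 hs.2)]
  have h2 : g (z - (z + s • (b.1 - z))) = s * g (z - b.1) := by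
    rw [show z - (z + s • (b.1 - z)) = s • (z - b.1) by module, hg.smul _ _ hs.1]
  generalize z + s • (b.1 - z) = z' at h1 h2
  have h3 : 0 ≤ s * g (z - b.1) := mul_nonneg hs.1 (hg.nonneg _)
  have hz1 : g (z - b.1) ≤ b.2 := hz
  have hz' : z' ∈ gball g b := by
    simp only [gball, mem_ofPred_eq]
    linarith
  have hh : height g b z' = height g b z - s * g (z - b.1) := by
    rw [hg.height_of_mem hb hz, hg.height_of_mem hb hz', h1]
    ring
  have hb0 : height g b z ≤ 0 := by
    rw [hg.height_of_mem hb hz]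
    linarith
  have hother : ∀ b' : Plane × ℝ, 0 < b'.2 → ∀ c ≤ 0, (c ≤ height g b' z →
      c ≤ g (z - b'.1) - b'.2) ∧ (c < height g b' z → c < g (z - b'.1) - b'.2) := by
    intro b' hb' c hc
    by_cases hm : z ∈ gball g b'
    · rw [hg.height_of_mem hb' hm]
      exact ⟨id, id⟩
    · have : b'.2 < g (z - b'.1) := not_le.1 hm
      exact ⟨fun _ => by linarith, fun _ => by linarith⟩
  refine ⟨fun b' hb' => ?_, fun S hS => ?_⟩
  · obtain ⟨h4, h5⟩ := hother b' hb' _ hb0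
    by_cases hm : z' ∈ gball g b'
    · rw [hh, hg.height_of_mem hb' hm]
      have h6 := hg.sub_le z z' b'.1
      exact ⟨fun h => by linarith [h4 h], fun h => by linarith [h5 h]⟩
    · have h6 := hg.gdist_pos hb' hm
      rw [hh, height_of_notMem hm]
      exact ⟨fun h => by linarith, fun h => by linarith⟩
  · right
    rcases hS with hS | ⟨a, ha, hS⟩
    · refine ⟨z, ?_, ?_⟩
      · exact le_trans (by linarith [le_max_right (height g b z) 0]) hS
      · rw [hh, h2]
        linarith
    · refine ⟨a, ha, ?_⟩
      have := hg.sub_le a z z'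
      rw [hh]
      linarith

theorem joinedIn_segment {D : Set Plane} {x y : Plane}
    (h : ∀ s ∈ Icc (0 : ℝ) 1, x + s • (y - x) ∈ D) : JoinedIn D x y :=
  JoinedIn.of_segment_subset (by
    rw [segment_eq_image']
    rintro _ ⟨s, hs, rfl⟩
    exact h s hs)

theorem joinedIn_toward (hg : IsGauge g) (hb : 0 < b.2) (z : Plane) :
    JoinedIn {z' | Toward g b z z'} z b.1 := by
  have hmem : ∀ {q : Plane}, q ∈ gball g b → JoinedIn {z' | Toward g b q z'} q b.1 :=
    fun hq => joinedIn_segment fun s hs => hg.toward_center hb hq hs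
  by_cases hz : z ∈ gball g b
  · exact hmem hz
  · obtain ⟨q, hq, hzq⟩ := hg.exists_gdist_eq hb z
    have h1 : JoinedIn {z' | Toward g b z z'} z q :=
      joinedIn_segment fun s hs => hg.toward_nearest hb hz hq hzq hs
    exact h1.trans ((hmem hq).mono fun z' hz' => Toward.trans h1.target_mem hz')

end IsGauge

open PlaneTopology

variable {ι : Type*} {s : ι → Plane × ℝ} {rank : ι → ℕ}

/-- `v` has the smallest height at `z` among the members of `T`, ties being broken by `rank`. -/
def Owner (g : Plane → ℝ) (s : ι → Plane × ℝ) (rank : ι → ℕ) (T : Finset ι) (z : Plane) (v : ι) :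
    Prop :=
  v ∈ T ∧ ∀ w ∈ T, height g (s v) z < height g (s w) z ∨
    height g (s v) z = height g (s w) z ∧ rank v ≤ rank w

theorem Owner.height_le {T : Finset ι} {z : Plane} {v w : ι} (h : Owner g s rank T z v)
    (hw : w ∈ T) : height g (s v) z ≤ height g (s w) z := by
  rcases h.2 w hw with h | h
  · exact h.le
  · exact h.1.le

theorem exists_owner (g : Plane → ℝ) (s : ι → Plane × ℝ) (rank : ι → ℕ) {T : Finset ι}
    (hT : T.Nonempty) (z : Plane) : ∃ v, Owner g s rank T z v := by
  obtain ⟨v, hv, h⟩ := T.exists_min_image (fun v => toLex (height g (s v) z, rank v)) hT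
  refine ⟨v, hv, fun w hw => ?_⟩
  simpa [Prod.Lex.le_iff] using h w hw

theorem Owner.toward (hs : ∀ v, 0 < (s v).2) {T : Finset ι} {z z' : Plane} {v : ι}
    (h : Owner g s rank T z v) (hz : Toward g (s v) z z') : Owner g s rank T z' v := by
  refine ⟨h.1, fun w hw => ?_⟩
  rcases h.2 w hw with h1 | ⟨h1, h2⟩
  · exact Or.inl ((hz.1 _ (hs w)).2 h1)
  · rcases ((hz.1 _ (hs w)).1 h1.le).lt_or_eq with h3 | h3
    · exact Or.inl h3
    · exact Or.inr ⟨h3, h2⟩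

theorem height_center_lt (hg : IsGauge g) (hs : ∀ v, 0 < (s v).2)
    (hanti : ∀ v w, gball g (s v) ⊆ gball g (s w) → v = w) {v w : ι} (hvw : v ≠ w) :
    height g (s v) (s v).1 < height g (s w) (s v).1 := by
  rw [hg.height_of_mem (hs v) (hg.center_mem (hs v)), sub_self, hg.map_zero, zero_sub]
  by_cases hm : (s v).1 ∈ gball g (s w)
  · rw [hg.height_of_mem (hs w) hm]
    by_contra! h
    refine hvw (hanti v w fun z hz => ?_)
    have h1 := hg.sub_le z (s v).1 (s w).1
    have h2 : g (z - (s v).1) ≤ (s v).2 := hz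
    simp only [gball, mem_ofPred_eq]
    linarith
  · have h1 := hg.gdist_pos (hs w) hm
    have h2 := hs v
    rw [IsGauge.height_of_notMem hm]
    linarith

/-- Some point at which `w` is best in `O` is not farther from `Q`. -/
theorem exists_height_le (hg : IsGauge g) (hs : ∀ v, 0 < (s v).2)
    (hanti : ∀ v w, gball g (s v) ⊆ gball g (s w) → v = w) {Q O : Finset ι}
    {S : Plane × ℝ} (hS : 0 < S.2) (hQ : ∃ v ∈ Q, (gball g S ∩ gball g (s v)).Nonempty)
    (hO : ∃ w ∈ O, (gball g S ∩ gball g (s w)).Nonempty) :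
    ∃ z w, Owner g s rank O z w ∧ Reaches g S z (height g (s w) z) ∧
      ∃ u ∈ Q, height g (s u) z ≤ height g (s w) z := by
  have key : ∀ T : Finset ι, (∃ v ∈ T, (gball g S ∩ gball g (s v)).Nonempty) →
      ∃ v, Owner g s rank T S.1 v ∧ Reaches g S S.1 (height g (s v) S.1) := by
    rintro T ⟨v, hv, hSv⟩
    obtain ⟨w, hw⟩ := exists_owner g s rank ⟨v, hv⟩ S.1
    exact ⟨w, hw, hg.reaches_of_inter_nonempty hS (hg.inter_nonempty_of_reaches (hs w)
      (hg.reaches_of_inter_nonempty hS hSv) (hw.height_le hv))⟩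
  obtain ⟨u, hu, hur⟩ := key Q hQ
  obtain ⟨w, hw, hwr⟩ := key O hO
  have hc : ∀ v, Continuous (height g (s v)) := fun v => hg.continuous_height (hs v)
  by_cases hcase : height g (s u) S.1 ≤ height g (s w) S.1
  · exact ⟨S.1, w, hw, hwr, u, hu.1, hcase⟩
  obtain ⟨γ, hγ⟩ := hg.joinedIn_toward (hs u) S.1
  have hcγ : ∀ v, Continuous fun t => height g (s v) (γ t) := fun v => (hc v).comp γ.continuous
  have hc1 : IsClosed (⋃ v ∈ O, {t | height g (s v) (γ t) ≤ height g (s u) (γ t)}) :=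
    O.finite_toSet.isClosed_biUnion fun v _ => isClosed_le (hcγ v) (hcγ u)
  have hc2 : IsClosed (⋂ v ∈ O, {t | height g (s u) (γ t) ≤ height g (s v) (γ t)}) :=
    isClosed_biInter fun v _ => isClosed_le (hcγ u) (hcγ v)
  obtain ⟨t, -, ht1, ht2⟩ := isPreconnected_closed_iff.1 (isPreconnected_univ (α := unitInterval))
    _ _ hc1 hc2 (fun t _ => by
      by_cases h : ∃ v ∈ O, height g (s v) (γ t) ≤ height g (s u) (γ t)
      · exact Or.inl (by simpa using h)
      · push Not at h
        exact Or.inr (by simpa using fun v hv => (h v hv).le))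
    ⟨0, mem_univ _, by simpa using ⟨w, hw.1, (not_le.1 hcase).le⟩⟩
    ⟨1, mem_univ _, by
      simp only [mem_iInter, mem_ofPred_eq, γ.target]
      intro v _
      rcases eq_or_ne u v with rfl | huv
      · exact le_rfl
      · exact (height_center_lt hg hs hanti huv).le⟩
  simp only [mem_iUnion, mem_iInter, mem_ofPred_eq, exists_prop] at ht1 ht2
  obtain ⟨v, hv, hvu⟩ := ht1
  obtain ⟨w', hw'⟩ := exists_owner g s rank ⟨v, hv⟩ (γ t)
  have he : height g (s w') (γ t) = height g (s u) (γ t) :=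
    le_antisymm ((hw'.height_le hv).trans hvu) (ht2 w' hw'.1)
  exact ⟨γ t, w', hw', he ▸ (hγ t).2 S hur, u, hu.1, he.ge⟩

variable [Fintype ι]

/-- The points owned by `v`. -/
def cell (g : Plane → ℝ) (s : ι → Plane × ℝ) (rank : ι → ℕ) (v : ι) : Set Plane :=
  {z | Owner g s rank Finset.univ z v}

theorem disjoint_cell (hrank : Function.Injective rank) {u v : ι} (huv : u ≠ v) :
    Disjoint (cell g s rank u) (cell g s rank v) := by
  refine Set.disjoint_left.2 fun z hu hv => huv (hrank ?_)
  have h1 := hu.2 v (Finset.mem_univ v)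
  have h2 := hv.2 u (Finset.mem_univ u)
  rcases h1 with h1 | h1 <;> rcases h2 with h2 | h2
  · exact (h1.not_gt h2).elim
  · exact (h1.ne' h2.1).elim
  · exact (h2.ne' h1.1).elim
  · exact le_antisymm h1.2 h2.2

theorem center_mem_cell (hg : IsGauge g) (hs : ∀ v, 0 < (s v).2)
    (hanti : ∀ v w, gball g (s v) ⊆ gball g (s w) → v = w) (v : ι) :
    (s v).1 ∈ cell g s rank v := by
  refine ⟨Finset.mem_univ v, fun w _ => ?_⟩
  rcases eq_or_ne v w with rfl | hvw
  · exact Or.inr ⟨rfl, le_rfl⟩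
  · exact Or.inl (height_center_lt hg hs hanti hvw)

theorem isPathConnected_cell (hg : IsGauge g) (hs : ∀ v, 0 < (s v).2)
    (hanti : ∀ v w, gball g (s v) ⊆ gball g (s w) → v = w) (v : ι) :
    IsPathConnected (cell g s rank v) := by
  exact ⟨(s v).1, center_mem_cell hg hs hanti v, fun {z} hz =>
    ((hg.joinedIn_toward (hs v) z).mono fun z' hz' => Owner.toward hs hz hz').symm⟩

/-- Every ball meeting both families meets two members which coincide or have adjacent cells. -/
theorem exists_cellAdj (hg : IsGauge g) (hs : ∀ v, 0 < (s v).2)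
    (hanti : ∀ v w, gball g (s v) ⊆ gball g (s w) → v = w) {Q O : Finset ι}
    (hQO : ∀ v, v ∈ Q ∨ v ∈ O) (hrank : ∀ u ∈ Q, ∀ w, w ∉ Q → rank u ≤ rank w)
    {S : Plane × ℝ} (hS : 0 < S.2) (hQ : ∃ v ∈ Q, (gball g S ∩ gball g (s v)).Nonempty)
    (hO : ∃ w ∈ O, (gball g S ∩ gball g (s w)).Nonempty) :
    ∃ u ∈ Q, ∃ w ∈ O, (gball g S ∩ gball g (s u)).Nonempty ∧
      (gball g S ∩ gball g (s w)).Nonempty ∧ (u = w ∨ CellAdj (cell g s rank) u w) := by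
  obtain ⟨z, w, hw, hwr, u₀, hu₀, hu₀w⟩ := exists_height_le (rank := rank) hg hs hanti hS hQ hO
  have hwS := hg.inter_nonempty_of_reaches (hs w) hwr le_rfl
  by_cases hwQ : w ∈ Q
  · exact ⟨w, hwQ, w, hw.1, hwS, hwS, Or.inl rfl⟩
  obtain ⟨γ, hγ⟩ := hg.joinedIn_toward (hs w) z
  have hcγ : ∀ v, Continuous fun t => height g (s v) (γ t) :=
    fun v => (hg.continuous_height (hs v)).comp γ.continuous
  have hc1 : IsClosed (⋃ v ∈ Q, {t | height g (s v) (γ t) ≤ height g (s w) (γ t)}) :=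
    Q.finite_toSet.isClosed_biUnion fun v _ => isClosed_le (hcγ v) (hcγ w)
  obtain ⟨t, ht, htmax⟩ := hc1.isCompact.exists_isGreatest
    ⟨0, by simpa using ⟨u₀, hu₀, hu₀w⟩⟩
  simp only [mem_iUnion, mem_ofPred_eq, exists_prop] at ht
  obtain ⟨v, hv, hvw⟩ := ht
  obtain ⟨u, hu⟩ := exists_owner g s rank ⟨v, hv⟩ (γ t)
  have huw := (hu.height_le hv).trans hvw
  have hown : ∀ t, Owner g s rank O (γ t) w := fun t => hw.toward hs (hγ t)
  have huS := hg.inter_nonempty_of_reaches (hs u) ((hγ t).2 S hwr) huw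
  have hne : u ≠ w := fun h => hwQ (h ▸ hu.1)
  refine ⟨u, hu.1, w, hw.1, huS, hwS, Or.inr ⟨hne, ?_⟩⟩
  have hut : γ t ∈ cell g s rank u := by
    refine ⟨Finset.mem_univ u, fun v _ => ?_⟩
    by_cases hvQ : v ∈ Q
    · exact hu.2 v hvQ
    · have hvO := (hQO v).resolve_left hvQ
      rcases (huw.trans ((hown t).height_le hvO)).lt_or_eq with h | h
      · exact Or.inl h
      · exact Or.inr ⟨h, hrank u hu.1 v hvQ⟩
  have hafter : ∀ t', t < t' → γ t' ∈ cell g s rank w := by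
    intro t' ht'
    refine ⟨Finset.mem_univ w, fun v _ => ?_⟩
    by_cases hvQ : v ∈ Q
    · left
      by_contra! h
      exact (htmax (mem_iUnion₂.2 ⟨v, hvQ, h⟩)).not_gt ht'
    · exact (hown t').2 v ((hQO v).resolve_left hvQ)
  have hIcc : IsPathConnected (γ '' Icc t 1) := by
    refine IsPathConnected.image ?_ γ.continuous
    rw [Topology.IsInducing.subtypeVal.isPathConnected_iff]
    convert (convex_Icc (t : ℝ) 1).isPathConnected ⟨1, t.2.2, le_rfl⟩ using 1
    ext x
    constructor
    · rintro ⟨x, hx, rfl⟩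
      exact hx
    · exact fun hx => ⟨⟨x, t.2.1.trans hx.1, hx.2⟩, hx, rfl⟩
  have h1 := ((isPathConnected_cell (rank := rank) hg hs hanti u).union hIcc
    ⟨γ t, hut, t, ⟨le_rfl, unitInterval.le_one'⟩, rfl⟩).union
    (isPathConnected_cell (rank := rank) hg hs hanti w)
    ⟨(s w).1, Or.inr ⟨1, ⟨unitInterval.le_one', le_rfl⟩, γ.target⟩, center_mem_cell hg hs hanti w⟩
  convert h1 using 1
  refine subset_antisymm (union_subset_union_left _ subset_union_left)
    (union_subset (union_subset subset_union_left ?_) subset_union_right)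
  rintro _ ⟨t', ht', rfl⟩
  rcases ht'.1.lt_or_eq with h | rfl
  · exact Or.inr (hafter t' h)
  · exact Or.inl hut

end GaugeCells

open GaugeCells GraphSeparation PlaneTopology

open scoped Pointwise in
theorem isGauge_gauge {K : Set Plane} (hK : IsCompact K) (hconv : Convex ℝ K)
    (h0 : K ∈ nhds 0) : IsGauge (gauge K) ∧ ∀ t : ℝ, 0 < t → {z | gauge K z ≤ t} = t • K := by
  have habs := absorbent_nhds_zero (𝕜 := ℝ) h0
  have hone : ∀ z, gauge K z ≤ 1 ↔ z ∈ K := fun z => by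
    rw [gauge_le_one_iff_mem_closure hconv h0, hK.isClosed.closure_eq]
  have hball : ∀ t : ℝ, 0 < t → {z | gauge K z ≤ t} = t • K := by
    intro t ht
    ext z
    rw [Set.mem_smul_set_iff_inv_smul_mem₀ ht.ne', ← hone, gauge_smul_of_nonneg (inv_nonneg.2 ht.le),
      smul_eq_mul, inv_mul_le_iff₀ ht, mul_one]
    rfl
  have hcont := continuous_gauge hconv h0
  refine ⟨⟨gauge_nonneg, gauge_add_le hconv habs, fun t x ht => gauge_smul_of_nonneg ht x,
    fun x hx => ?_, hcont, fun t => ?_⟩, hball⟩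
  · exact (gauge_eq_zero habs ((NormedSpace.isVonNBounded_iff ℝ).2 hK.isBounded)).1 hx
  · have h1 : {z | gauge K z ≤ max t 1} = (max t 1) • K := hball _ (by positivity)
    have h2 : IsCompact {z | gauge K z ≤ max t 1} := h1 ▸ hK.smul (max t 1)
    exact h2.of_isClosed_subset (isClosed_le hcont continuous_const)
      fun z (hz : gauge K z ≤ t) =>
        show gauge K z ≤ max t 1 from hz.trans (le_max_left _ _)

open scoped Pointwise in
/-- The homothets of a convex body are the balls of a gauge. -/
theorem exists_gauge_of_convexBody {C : Set Plane} (hC : IsCompact C) (hconv : Convex ℝ C)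
    (hCint : (interior C).Nonempty) : ∃ g, IsGauge g ∧
      ∀ S, IsHomothetOf C S → ∃ b : Plane × ℝ, 0 < b.2 ∧ gball g b = S := by
  obtain ⟨c, hc⟩ := hCint
  obtain ⟨hg, hball⟩ := isGauge_gauge (K := (fun x => -c + x) '' C)
    (hC.image (by fun_prop)) (hconv.translate (-c)) (by
      rw [image_add_left, neg_neg]
      exact (continuous_const_add c).continuousAt.preimage_mem_nhds
        (by simpa using mem_interior_iff_mem_nhds.1 hc))
  refine ⟨_, hg, ?_⟩
  rintro S ⟨x, t, ht, rfl⟩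
  refine ⟨(x + t • c, t), ht, ?_⟩
  have h := hball t ht
  ext z
  have hz := Set.ext_iff.1 h (z - (x + t • c))
  rw [mem_ofPred_eq] at hz
  rw [gball, mem_ofPred_eq, hz, Set.mem_smul_set]
  simp only [mem_image, exists_exists_and_eq_and]
  refine exists_congr fun y => and_congr_right fun _ => ?_
  rw [eq_sub_iff_add_eq]
  refine Eq.congr ?_ rfl
  module

theorem le_of_locally_optimal_of_antichain {g : Plane → ℝ} (hg : IsGauge g)
    {𝒮 𝒬 𝒪 : Finset (Set Plane)}
    (hball : ∀ S ∈ 𝒮, ∃ b : Plane × ℝ, 0 < b.2 ∧ gball g b = S) (hQS : 𝒬 ⊆ 𝒮) (hOS : 𝒪 ⊆ 𝒮)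
    (hQ : DominatingIn 𝒮 𝒬) (hO : DominatingIn 𝒮 𝒪)
    (hanti : ∀ S ∈ 𝒬 ∪ 𝒪, ∀ T ∈ 𝒬 ∪ 𝒪, S ⊆ T → S = T) {b : ℕ} (hb : (204 : ℝ) ≤ √(b : ℝ))
    (hopt : BLocallyOptimalDom 𝒮 𝒬 b) :
    (𝒬.card : ℝ) ≤ 𝒪.card + 2 * (204 / √(b : ℝ)) * (𝒬.card + 𝒪.card) := by
  have hVS : 𝒬 ∪ 𝒪 ⊆ 𝒮 := Finset.union_subset hQS hOS
  choose! s hs hsS using hball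
  let σ : ↥(𝒬 ∪ 𝒪) → Plane × ℝ := fun v => s v
  have hσ : ∀ v, 0 < (σ v).2 := fun v => hs v (hVS v.2)
  have hσS : ∀ v, gball g (σ v) = v := fun v => hsS v (hVS v.2)
  have hσanti : ∀ v w, gball g (σ v) ⊆ gball g (σ w) → v = w := fun v w h =>
    Subtype.ext (hanti v v.2 w w.2 (by rwa [hσS, hσS] at h))
  let e := Fintype.equivFin ↥(𝒬 ∪ 𝒪)
  let rank : ↥(𝒬 ∪ 𝒪) → ℕ := fun v =>
    if (v : Set Plane) ∈ 𝒬 then e v else Fintype.card ↥(𝒬 ∪ 𝒪) + e v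
  have hrank : Function.Injective rank := by
    intro v w h
    have h1 := (e v).2
    have h2 := (e w).2
    refine e.injective (Fin.ext ?_)
    simp only [rank] at h
    split_ifs at h <;> omega
  let Q : Finset ↥(𝒬 ∪ 𝒪) := Finset.univ.filter fun v => (v : Set Plane) ∈ 𝒬
  let O : Finset ↥(𝒬 ∪ 𝒪) := Finset.univ.filter fun v => (v : Set Plane) ∈ 𝒪
  have hmemQ : ∀ v, v ∈ Q ↔ (v : Set Plane) ∈ 𝒬 := fun v => by simp [Q]
  have hmemO : ∀ v, v ∈ O ↔ (v : Set Plane) ∈ 𝒪 := fun v => by simp [O]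
  let i := Function.Embedding.subtype fun v => v ∈ 𝒬 ∪ 𝒪
  have hcardQ : Q.card = 𝒬.card := by
    rw [← Finset.card_map i]
    congr 1
    ext v
    simpa [i, Q] using fun h => Or.inl h
  have hcardO : O.card = 𝒪.card := by
    rw [← Finset.card_map i]
    congr 1
    ext v
    simpa [i, O] using fun h => Or.inr h
  have hexch : ∀ S ∈ 𝒮, ∃ u ∈ Q, ∃ w ∈ O, (S ∩ u).Nonempty ∧ (S ∩ w).Nonempty ∧
      (u = w ∨ CellAdj (cell g σ rank) u w) := by
    intro S hS
    obtain ⟨u, hu, hSu⟩ := hQ S hS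
    obtain ⟨w, hw, hSw⟩ := hO S hS
    have := exists_cellAdj (s := σ) (rank := rank) (Q := Q) (O := O) (S := s S) hg hσ hσanti
      (fun v => by
        rw [hmemQ, hmemO]
        exact Finset.mem_union.1 v.2)
      (fun u hu w hw => by
        rw [hmemQ] at hu hw
        simp only [rank, hu, hw, if_true, if_false]
        omega)
      (hs S hS)
      ⟨⟨u, Finset.mem_union_left _ hu⟩, (hmemQ _).2 hu, by rwa [hσS, hsS S hS]⟩
      ⟨⟨w, Finset.mem_union_right _ hw⟩, (hmemO _).2 hw, by rwa [hσS, hsS S hS]⟩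
    simpa only [hσS, hsS S hS] using this
  rw [← hcardQ, ← hcardO]
  refine card_le_of_locally_optimal CellAdj.symm
    (noK5_cellAdj (isPathConnected_cell hg hσ hσanti) fun u v => disjoint_cell hrank) hb Q O ?_
  intro P X _ hPb hXQ hXP hadj
  by_contra! hlt
  refine hopt ⟨X.map i, ?_, ?_, (O ∩ P).map i, ?_, ?_, ?_⟩
  · intro v hv
    obtain ⟨v, hvX, rfl⟩ := Finset.mem_map.1 hv
    exact (hmemQ v).1 (hXQ hvX)
  · rw [Finset.card_map]
    exact (Finset.card_le_card hXP).trans hPb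
  · intro v hv
    obtain ⟨v, -, rfl⟩ := Finset.mem_map.1 hv
    exact hVS v.2
  · rw [Finset.card_map, Finset.card_map]
    refine lt_of_eq_of_lt (congrArg Finset.card ?_) hlt
    ext v
    simp only [Finset.mem_inter]
  · intro S hS
    obtain ⟨u, hu, w, hw, hSu, hSw, huw⟩ := hexch S hS
    by_cases huX : u ∈ X
    · refine ⟨w, Finset.mem_union_right _ (Finset.mem_map.2 ⟨w, Finset.mem_inter.2 ⟨hw, ?_⟩, rfl⟩),
        hSw⟩
      rcases huw with rfl | huw
      · exact hXP huX
      · exact hadj u huX w hw huw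
    · refine ⟨u, Finset.mem_union_left _ (Finset.mem_sdiff.2 ⟨(hmemQ u).1 hu, fun h => huX ?_⟩), hSu⟩
      obtain ⟨v, hv, hvu⟩ := Finset.mem_map.1 h
      rwa [← Subtype.ext hvu]

theorem eq_of_subset_of_stable {𝒮 𝒬 : Finset (Set Plane)} {b : ℕ} (hb : 1 ≤ b)
    (hQ : DominatingIn 𝒮 𝒬) (hopt : BLocallyOptimalDom 𝒮 𝒬 b)
    (hstable : ¬ ∃ Q ∈ 𝒬, ∃ R ∈ 𝒮, R ∉ 𝒬 ∧
      (Q \ ⋃ P ∈ 𝒬.erase Q, (P : Set Plane)) ⊆ R) {Q R : Set Plane} (hQQ : Q ∈ 𝒬) (hR : R ∈ 𝒮)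
    (h : Q ⊆ R) : Q = R := by
  by_contra hne
  by_cases hRQ : R ∈ 𝒬
  · refine hopt ⟨{Q}, by simpa using hQQ, by simpa using hb, ∅, by simp, by simp, fun S hS => ?_⟩
    obtain ⟨P, hP, hSP⟩ := hQ S hS
    rcases eq_or_ne P Q with rfl | hPQ
    · exact ⟨R, by simp [hRQ, Ne.symm hne], hSP.mono (inter_subset_inter_right _ h)⟩
    · exact ⟨P, by simp [hP, hPQ], hSP⟩
  · exact hstable ⟨Q, hQQ, R, hR, hRQ, sdiff_subset.trans h⟩

/-- Every dominating set can be replaced by one consisting of maximal sets. -/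
theorem exists_dominatingIn_maximal {𝒮 𝒪 : Finset (Set Plane)} (hOS : 𝒪 ⊆ 𝒮)
    (hO : DominatingIn 𝒮 𝒪) : ∃ 𝒪' ⊆ 𝒮, DominatingIn 𝒮 𝒪' ∧ 𝒪'.card ≤ 𝒪.card ∧
      ∀ S ∈ 𝒪', ∀ T ∈ 𝒮, S ⊆ T → S = T := by
  have hmax : ∀ S : Set Plane, ∃ T, S ∈ 𝒮 → S ⊆ T ∧ Maximal (· ∈ 𝒮) T := by
    intro S
    by_cases hS : S ∈ 𝒮
    · obtain ⟨T, hST, hT⟩ := 𝒮.exists_le_maximal hS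
      exact ⟨T, fun _ => ⟨hST, hT⟩⟩
    · exact ⟨S, fun h => (hS h).elim⟩
  choose f hf using hmax
  refine ⟨𝒪.image f, ?_, fun S hS => ?_, Finset.card_image_le, ?_⟩
  · intro T hT
    obtain ⟨S, hS, rfl⟩ := Finset.mem_image.1 hT
    exact (hf S (hOS hS)).2.prop
  · obtain ⟨P, hP, hSP⟩ := hO S hS
    exact ⟨f P, Finset.mem_image_of_mem f hP,
      hSP.mono (inter_subset_inter_right _ (hf P (hOS hP)).1)⟩
  · intro T hT R hR hTR
    obtain ⟨S, hS, rfl⟩ := Finset.mem_image.1 hT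
    exact (hf S (hOS hS)).2.eq_of_le hR hTR

theorem local_search_ptas_dominating_set_homothets :
    ∃ α : ℝ, 0 < α ∧
      ∀ C : Set Plane, IsCompact C → Convex ℝ C → (interior C).Nonempty →
      ∀ 𝒮 : Finset (Set Plane), (∀ S ∈ 𝒮, IsHomothetOf C S) →
      ∀ 𝒪 : Finset (Set Plane), 𝒪 ⊆ 𝒮 → DominatingIn 𝒮 𝒪 →
        (∀ 𝒪' : Finset (Set Plane), 𝒪' ⊆ 𝒮 → DominatingIn 𝒮 𝒪' →
          𝒪.card ≤ 𝒪'.card) →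
      ∀ ε : ℝ, 0 < ε → ε < 1 →
      ∀ b : ℕ, α / ε ^ 2 ≤ (b : ℝ) →
      ∀ 𝒬 : Finset (Set Plane), 𝒬 ⊆ 𝒮 → DominatingIn 𝒮 𝒬 →
        BLocallyOptimalDom 𝒮 𝒬 b →
        (¬ ∃ Q ∈ 𝒬, ∃ R ∈ 𝒮, R ∉ 𝒬 ∧
            (Q \ ⋃ P ∈ 𝒬.erase Q, (P : Set Plane)) ⊆ R) →
        (𝒬.card : ℝ) ≤ (1 + ε) * 𝒪.card := by
  refine ⟨1632 ^ 2, by norm_num, ?_⟩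
  intro C hC hconv hCint 𝒮 hS 𝒪 hOS hO _ ε hε hε1 b hb 𝒬 hQS hQ hopt hstable
  have hsqrt : 1632 / ε ≤ √(b : ℝ) := by
    refine Real.le_sqrt_of_sq_le ?_
    rwa [div_pow]
  have h1632 : (1632 : ℝ) ≤ 1632 / ε := le_div_self (by norm_num) hε hε1.le
  have hb1 : 1 ≤ b := by
    by_contra! h
    interval_cases b
    simp at hsqrt
    linarith
  obtain ⟨g, hg, hball⟩ := exists_gauge_of_convexBody hC hconv hCint
  obtain ⟨𝒪', hOS', hO', hcard, hmax⟩ := exists_dominatingIn_maximal hOS hO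
  have hle := le_of_locally_optimal_of_antichain hg (fun S h => hball S (hS S h)) hQS hOS' hQ hO'
    (fun S hSm T hT hST => by
      have hT' := Finset.union_subset hQS hOS' hT
      rcases Finset.mem_union.1 hSm with h | h
      · exact eq_of_subset_of_stable hb1 hQ hopt hstable h hT' hST
      · exact hmax S h T hT' hST)
    (by linarith) hopt
  have hq : 2 * (204 / √(b : ℝ)) ≤ ε / 4 := by
    have h : 0 < √(b : ℝ) := by linarith
    rw [div_le_iff₀ hε] at hsqrt
    rw [mul_div_assoc', div_le_iff₀ h]
    linarith
  have hcard' : (𝒪'.card : ℝ) ≤ 𝒪.card := by exact_mod_cast hcard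
  have h1 := mul_le_mul_of_nonneg_right hq (show (0 : ℝ) ≤ 𝒬.card + 𝒪'.card by positivity)
  have h2 : (𝒬.card : ℝ) * (1 - ε / 4) ≤ 𝒪.card * (1 + ε / 4) := by nlinarith
  have h3 : (𝒪.card : ℝ) * (1 + ε / 4) ≤ (1 + ε) * 𝒪.card * (1 - ε / 4) := by
    have h4 : 1 + ε / 4 ≤ (1 + ε) * (1 - ε / 4) := by nlinarith
    have := mul_le_mul_of_nonneg_right h4 (show (0 : ℝ) ≤ 𝒪.card by positivity)
    linarith
  exact le_of_mul_le_mul_right (h2.trans h3) (by linarith)
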